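/- Let K = ℚ(√2) (viewed with its embedding in ℝ, s = √2) and α = 21 + 4s ∈ K. Consider the set Ω of pairs (x, y) ∈ K² satisfying α·y² = x³ + 5s·x² − x, with x ≠ 6 − 4s, such that π(x) := 2(−4 + 2s − x(1 − s))/(6 − 4s − x) is a rational number which, written as a fraction a/b in lowest terms, satisfies 5 ∤ b and a ≡ −b (mod 5). Then Ω = {(x₀, y₀), (x₀, −y₀)}, where x₀ = (−2/49)(−663 + 458s) and y₀ = (69/343)(−232 + 163s). -/

import Mathlib

open IntermediateField

/-- The real quadratic field `K = ℚ(√2)`, realized inside `ℝ`. -/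
noncomputable def Qsqrt2 : IntermediateField ℚ ℝ := ℚ⟮Real.sqrt 2⟯

/-- The element `√2` of `ℚ(√2)`. -/
noncomputable def sq2 : Qsqrt2 := ⟨Real.sqrt 2, mem_adjoin_simple_self ℚ (Real.sqrt 2)⟩

namespace EC

abbrev O := Zsqrtd 2

theorem norm_def' (z : O) : z.norm = z.re * z.re - 2 * z.im * z.im := rfl

theorem norm_zero_iff (z : O) : z.norm = 0 ↔ z = 0 := by
  apply Zsqrtd.norm_eq_zero
  intro n h
  have h1 : n < 2 := by nlinarith
  have h2 : -2 < n := by nlinarith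
  interval_cases n <;> omega

instance : IsDomain O := by
  have : NoZeroDivisors O := ⟨by
    intro a b h
    have := congrArg Zsqrtd.norm h
    rw [Zsqrtd.norm_mul, Zsqrtd.norm_zero, mul_eq_zero] at this
    rcases this with h | h
    · exact Or.inl ((norm_zero_iff _).1 h)
    · exact Or.inr ((norm_zero_iff _).1 h)⟩
  exact NoZeroDivisors.to_isDomain _

theorem exists_round (z n : ℤ) (hn : n ≠ 0) : ∃ q : ℤ, |2 * (z - n * q)| ≤ |n| := by
  refine ⟨round ((z : ℚ) / n), ?_⟩
  have h := abs_sub_round ((z : ℚ) / n)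
  have hn' : (n : ℚ) ≠ 0 := by exact_mod_cast hn
  have h2 : (2 * ((z:ℚ) - n * (round ((z : ℚ) / n) : ℤ))) = 2 * n * ((z : ℚ) / n - round ((z : ℚ) / n)) := by
    field_simp
  have h3 : |(2 * ((z:ℚ) - n * (round ((z : ℚ) / n) : ℤ)))| ≤ |(n:ℚ)| := by
    rw [h2, abs_mul, abs_mul]
    have := abs_nonneg (n:ℚ)
    rw [abs_two]
    nlinarith
  exact_mod_cast h3

theorem exists_div (x y : O) (hy : y ≠ 0) : ∃ q : O, (x - y * q).norm.natAbs < y.norm.natAbs := by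
  have hn : y.norm ≠ 0 := fun h => hy ((norm_zero_iff _).1 h)
  obtain ⟨q1, h1⟩ := exists_round (x * star y).re y.norm hn
  obtain ⟨q2, h2⟩ := exists_round (x * star y).im y.norm hn
  refine ⟨⟨q1, q2⟩, ?_⟩
  set n := y.norm with hnd
  set r := x - y * ⟨q1, q2⟩ with hr
  have hrs : r * star y = ⟨(x * star y).re - n * q1, (x * star y).im - n * q2⟩ := by
    rw [hr, hnd]
    ext <;> simp [Zsqrtd.norm_def] <;> ring
  have hN : r.norm * n = ((x * star y).re - n * q1) * ((x * star y).re - n * q1) - 2 * ((x * star y).im - n * q2) * ((x * star y).im - n * q2) := by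
    have := congrArg Zsqrtd.norm hrs
    rw [Zsqrtd.norm_mul, Zsqrtd.norm_conj] at this
    rw [hnd, this, norm_def']
  generalize (x * star y).re - n * q1 = a at *
  generalize (x * star y).im - n * q2 = b at *
  have ha : 4 * (a * a) ≤ n * n := by
    have := sq_le_sq.2 h1; nlinarith
  have hb : 4 * (b * b) ≤ n * n := by
    have := sq_le_sq.2 h2; nlinarith
  have hnn : 0 < n * n := by have := mul_self_pos.2 hn; exact this
  have : |r.norm| < |n| := by
    have h3 : |r.norm| * |n| < |n| * |n| := by
      rw [← abs_mul, hN, abs_mul_abs_self, abs_lt]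
      constructor <;> nlinarith [mul_self_nonneg a, mul_self_nonneg b]
    exact lt_of_mul_lt_mul_right h3 (abs_nonneg _)
  rw [Int.abs_eq_natAbs, Int.abs_eq_natAbs] at this
  exact_mod_cast this

open Classical in
@[reducible] noncomputable def euclO : EuclideanDomain O :=
  { (inferInstance : CommRing O), (inferInstance : Nontrivial O) with
    quotient := fun x y => if hy : y = 0 then 0 else Classical.choose (exists_div x y hy)
    remainder := fun x y => x - y * (if hy : y = 0 then 0 else Classical.choose (exists_div x y hy))
    quotient_zero := by intro a; simp
    quotient_mul_add_remainder_eq := by intro a b; ring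
    r := fun x y => x.norm.natAbs < y.norm.natAbs
    r_wellFounded := (measure (Zsqrtd.norm · |>.natAbs)).wf
    remainder_lt := by
      intro a b hb
      simp only [hb, dif_neg, not_false_eq_true]
      exact Classical.choose_spec (exists_div a b hb)
    mul_left_not_lt := by
      intro a b hb
      rw [Zsqrtd.norm_mul, Int.natAbs_mul, not_lt]
      have : b.norm ≠ 0 := fun h => hb ((norm_zero_iff _).1 h)
      exact Nat.le_mul_of_pos_right _ (Int.natAbs_pos.2 this) }

instance : IsPrincipalIdealRing O :=
  @EuclideanDomain.to_principal_ideal_domain O euclO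

example : UniqueFactorizationMonoid O := inferInstance
example : IsIntegrallyClosed O := inferInstance

/-- fundamental unit -/
def ep : O := ⟨1, 1⟩

theorem ep_norm : ep.norm = -1 := rfl

def fs : Pell.Solution₁ 2 := Pell.Solution₁.mk 3 2 (by norm_num)

theorem fs_coe : ((fs : Pell.Solution₁ 2) : O) = ep * ep := by
  rw [fs, Pell.Solution₁.coe_mk]; rfl

theorem fs_fund : Pell.IsFundamental fs := by
  refine ⟨by simp [fs], by simp [fs], ?_⟩
  intro b hb
  simp only [fs, Pell.Solution₁.x_mk]
  have := b.prop
  by_contra h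
  have h2 : b.x = 2 := by omega
  rw [h2] at this
  omega

def phi : Pell.Solution₁ 2 →* Oˣ := (Unitary.toUnits : unitary (ℤ√2) →* (ℤ√2)ˣ)

theorem phi_val (b : Pell.Solution₁ 2) : ((phi b : Oˣ) : O) = (b : O) := rfl

theorem sol_sq (b : Pell.Solution₁ 2) : ∃ u : O, IsUnit u ∧ ((b : O) = u * u ∨ (b : O) = -(u * u)) := by
  have hep : IsUnit ep := Zsqrtd.norm_eq_one_iff.1 rfl
  obtain ⟨e, he⟩ := hep
  have key : ∀ n : ℤ, ((fs ^ n : Pell.Solution₁ 2) : O) = ((e ^ n : Oˣ) : O) * ((e ^ n : Oˣ) : O) := by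
    intro n
    have hfe : phi fs = e * e := by
      ext1
      rw [phi_val, fs_coe, Units.val_mul, he]
    have h1 : phi (fs ^ n) = e ^ n * e ^ n := by
      rw [map_zpow, hfe, mul_zpow]
    rw [← phi_val, h1, Units.val_mul]
  obtain ⟨n, h | h⟩ := fs_fund.eq_zpow_or_neg_zpow b
  · exact ⟨_, (e ^ n).isUnit, Or.inl (by rw [h, key])⟩
  · refine ⟨_, (e ^ n).isUnit, Or.inr (by rw [h, ← key]; rfl)⟩

theorem unit_class (v : O) (hv : IsUnit v) : ∃ c u : O, IsUnit u ∧ v = c * (u * u) ∧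
    (c = 1 ∨ c = -1 ∨ c = ep ∨ c = -ep) := by
  have h := Zsqrtd.norm_eq_one_iff.2 hv
  rcases Int.natAbs_eq v.norm with h1 | h1 <;> rw [h] at h1
  · have hp : v.re ^ 2 - 2 * v.im ^ 2 = 1 := by
      have := norm_def' v; push_cast at h1; rw [h1] at this; linarith
    obtain ⟨u, hu, h2 | h2⟩ := sol_sq (Pell.Solution₁.mk v.re v.im hp)
    · exact ⟨1, u, hu, by rw [one_mul, ← h2]; rfl, by simp⟩
    · exact ⟨-1, u, hu, by rw [neg_one_mul, ← h2]; rfl, by simp⟩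
  · -- multiply by ep
    obtain ⟨w, hw⟩ : ∃ w, w = ep * v := ⟨_, rfl⟩
    have hwn : w.norm = 1 := by rw [hw, Zsqrtd.norm_mul, h1, ep_norm]; rfl
    have hp : w.re ^ 2 - 2 * w.im ^ 2 = 1 := by
      have := norm_def' w; rw [hwn] at this; linarith
    have hi : ep * (⟨-1, 1⟩ : O) = 1 := rfl
    have hi2 : IsUnit (⟨-1, 1⟩ : O) := Zsqrtd.norm_eq_one_iff.1 rfl
    have hv' : v = (⟨-1, 1⟩ : O) * w := by
      rw [hw]; linear_combination (-v) * hi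
    obtain ⟨u, hu, h2 | h2⟩ := sol_sq (Pell.Solution₁.mk w.re w.im hp)
    · refine ⟨ep, (⟨-1, 1⟩ : O) * u, hi2.mul hu, ?_, by simp⟩
      have : w = u * u := by rw [← h2]; rfl
      rw [hv', this]; linear_combination (-(⟨-1, 1⟩ : O) * u * u) * hi
    · refine ⟨-ep, (⟨-1, 1⟩ : O) * u, hi2.mul hu, ?_, by simp⟩
      have : w = -(u * u) := by rw [← h2]; rfl
      rw [hv', this]; linear_combination ((⟨-1, 1⟩ : O) * u * u) * hi

end EC

namespace EC

noncomputable abbrev K := Qsqrt2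

theorem s_sq : sq2 * sq2 = (2 : K) := by
  apply Subtype.ext
  have : (Real.sqrt 2) * Real.sqrt 2 = 2 := Real.mul_self_sqrt (by norm_num)
  exact this

theorem s_sq' : sq2 ^ 2 = (2 : K) := by rw [pow_two, s_sq]

theorem K_rep (x : K) : ∃ a b : ℚ, x = (a : K) + (b : K) * sq2 := by
  obtain ⟨x, hx⟩ := x
  have hx' : x ∈ Algebra.adjoin ℚ {Real.sqrt 2} := by
    have hi : IsIntegral ℚ (Real.sqrt 2) := by
      refine ⟨Polynomial.X ^ 2 - Polynomial.C 2, Polynomial.monic_X_pow_sub_C _ (by norm_num), ?_⟩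
      simp
    rw [← IntermediateField.adjoin_simple_toSubalgebra_of_isAlgebraic hi.isAlgebraic]
    exact hx
  have key : ∃ a b : ℚ, x = (a : ℝ) + (b : ℝ) * Real.sqrt 2 := by
    clear hx
    have h2 : (Real.sqrt 2) * Real.sqrt 2 = 2 := Real.mul_self_sqrt (by norm_num)
    induction hx' using Algebra.adjoin_induction with
    | mem x hx => 
      rw [Set.mem_singleton_iff] at hx
      exact ⟨0, 1, by rw [hx]; simp⟩
    | algebraMap r => exact ⟨r, 0, by simp⟩
    | add x y _ _ hx hy =>
      obtain ⟨a, b, rfl⟩ := hx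
      obtain ⟨c, d, rfl⟩ := hy
      exact ⟨a + c, b + d, by push_cast; ring⟩
    | mul x y _ _ hx hy =>
      obtain ⟨a, b, rfl⟩ := hx
      obtain ⟨c, d, rfl⟩ := hy
      exact ⟨a * c + 2 * b * d, a * d + b * c, by push_cast; linear_combination (b * d : ℝ) * h2⟩
  obtain ⟨a, b, h⟩ := key
  refine ⟨a, b, Subtype.ext ?_⟩
  simpa [sq2] using h

theorem K_uniq (a b : ℚ) (h : (a : K) + (b : K) * sq2 = 0) : a = 0 ∧ b = 0 := by
  have h1 : (a : ℝ) + b * Real.sqrt 2 = 0 := by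
    have := congrArg (Subtype.val) h
    simpa [sq2] using this
  by_cases hb : b = 0
  · subst hb
    simp at h1
    exact ⟨h1, rfl⟩
  · exfalso
    have hb' : (b : ℝ) ≠ 0 := by exact_mod_cast hb
    apply irrational_sqrt_two
    refine ⟨-a / b, ?_⟩
    push_cast
    field_simp
    linarith

instance : FiniteDimensional ℚ K := by
  have hi : IsIntegral ℚ (Real.sqrt 2) := by
    refine ⟨Polynomial.X ^ 2 - Polynomial.C 2, Polynomial.monic_X_pow_sub_C _ (by norm_num), ?_⟩
    simp
  exact IntermediateField.adjoin.finiteDimensional hi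

instance : NumberField K := ⟨⟩

/-- the embedding of `ℤ[√2]` -/
noncomputable def io : O →+* K := Zsqrtd.lift ⟨sq2, by rw [s_sq]; norm_num⟩

theorem io_def (z : O) : io z = (z.re : K) + (z.im : K) * sq2 := rfl

theorem io_mk (a b : ℤ) : io ⟨a, b⟩ = (a : K) + (b : K) * sq2 := rfl

theorem io_inj : Function.Injective io := by
  rw [injective_iff_map_eq_zero]
  intro z hz
  rw [io_def] at hz
  have := K_uniq z.re z.im (by exact_mod_cast hz)
  ext
  · exact_mod_cast this.1
  · exact_mod_cast this.2

theorem io_eq_zero {z : O} : io z = 0 ↔ z = 0 := map_eq_zero_iff io io_inj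

theorem K_frac (x : K) : ∃ (z : O) (n : ℕ), n ≠ 0 ∧ x = io z / (n : K) := by
  obtain ⟨a, b, rfl⟩ := K_rep x
  refine ⟨⟨a.num * b.den, b.num * a.den⟩, a.den * b.den, by positivity, ?_⟩
  have ha : ((a.den : ℚ) : K) ≠ 0 := by exact_mod_cast a.den_nz
  have hb : ((b.den : ℚ) : K) ≠ 0 := by exact_mod_cast b.den_nz
  have h1 : ((a.num : ℚ) : K) = ((a : ℚ) : K) * ((a.den : ℚ) : K) := by exact_mod_cast (Rat.mul_den_eq_num a).symm
  have h2 : ((b.num : ℚ) : K) = ((b : ℚ) : K) * ((b.den : ℚ) : K) := by exact_mod_cast (Rat.mul_den_eq_num b).symm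
  rw [io_mk]
  push_cast at *
  rw [h1, h2]
  field_simp

/-- the element `√2` of `ℤ[√2]` -/
def so : O := ⟨0, 1⟩
def alo : O := ⟨21, 4⟩

theorem so_sq : so * so = 2 := rfl
theorem io_so : io so = sq2 := by rw [so, io_mk]; simp
theorem io_alo : io alo = 21 + 4 * sq2 := by rw [alo, io_mk]; simp
theorem alo_eq : alo = 21 + 4 * so := rfl
theorem ep_eq : ep = 1 + so := rfl

instance : Fact (Nat.Prime 409) := ⟨by norm_num⟩
def f9 : O →+* ZMod 409 := Zsqrtd.lift ⟨97, by decide⟩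

theorem f9_def (z : O) : f9 z = (z.re : ZMod 409) + (z.im : ZMod 409) * 97 := rfl

theorem f9_alo : f9 alo = 0 := by rw [f9_def]; decide

theorem alo_dvd {z : O} (h : f9 z = 0) : alo ∣ z := by
  rw [f9_def] at h
  have h2 : ((z.re + z.im * 97 : ℤ) : ZMod 409) = 0 := by push_cast; exact h
  rw [ZMod.intCast_zmod_eq_zero_iff_dvd] at h2
  obtain ⟨k, hk⟩ := h2
  push_cast at hk
  -- z = (409 k - 97 im) + im s
  have h97 : ∃ t : O, (⟨-97, 1⟩ : O) = alo * t := ⟨⟨-5, 1⟩, by rfl⟩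
  obtain ⟨t, ht⟩ := h97
  have h409 : (409 : O) = alo * ⟨21, -4⟩ := rfl
  refine ⟨⟨21, -4⟩ * (k : O) + t * (z.im : O), ?_⟩
  have hz : z = (409 : O) * (k : O) + ⟨-97, 1⟩ * (z.im : O) := by
    ext
    · simp; linarith
    · simp
  rw [mul_add, ← mul_assoc, ← mul_assoc, ← h409, ← ht]
  exact hz

theorem f9_eq_zero {z : O} : f9 z = 0 ↔ alo ∣ z :=
  ⟨alo_dvd, by rintro ⟨t, rfl⟩; rw [map_mul, f9_alo, zero_mul]⟩

theorem prime_alo : Prime alo := by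
  refine ⟨by decide, ?_, ?_⟩
  · intro h
    have := h.map f9
    rw [f9_alo] at this
    exact not_isUnit_zero this
  · intro a b h
    rw [← f9_eq_zero, map_mul, mul_eq_zero] at h
    rwa [← f9_eq_zero, ← f9_eq_zero]

theorem so_dvd {z : O} : so ∣ z ↔ (2 : ℤ) ∣ z.re := by
  constructor
  · rintro ⟨t, rfl⟩; exact ⟨t.im, by simp [so]⟩
  · rintro ⟨k, hk⟩
    exact ⟨⟨z.im, k⟩, by ext <;> simp [so, hk]⟩

theorem prime_so : Prime so := by
  refine ⟨by decide, ?_, ?_⟩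
  · intro h
    have := isUnit_iff_dvd_one.1 h
    rw [so_dvd] at this
    revert this; decide
  · intro a b h
    rw [so_dvd] at *
    rw [so_dvd]
    have : (2:ℤ) ∣ a.re * b.re := by
      rw [Zsqrtd.re_mul, mul_assoc] at h
      exact (Int.dvd_add_left (Dvd.intro _ rfl)).1 h
    exact Int.prime_two.dvd_or_dvd this

theorem three_dvd {z : O} : (3 : O) ∣ z ↔ (3 : ℤ) ∣ z.re ∧ (3 : ℤ) ∣ z.im := by
  have := Zsqrtd.intCast_dvd (d := 2) 3 z
  exact_mod_cast this

theorem prime_three : Prime (3 : O) := by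
  refine ⟨by decide, ?_, ?_⟩
  · intro h
    have := isUnit_iff_dvd_one.1 h
    rw [three_dvd] at this
    revert this; decide
  · intro a b h
    rw [three_dvd] at *
    rw [three_dvd]
    have key : ∀ a1 a2 b1 b2 : ZMod 3, a1 * b1 + 2 * a2 * b2 = 0 → a1 * b2 + a2 * b1 = 0 →
      (a1 = 0 ∧ a2 = 0) ∨ (b1 = 0 ∧ b2 = 0) := by decide
    have c : ∀ z : ℤ, (3 : ℤ) ∣ z ↔ (z : ZMod 3) = 0 := fun z => (ZMod.intCast_zmod_eq_zero_iff_dvd z 3).symm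
    simp only [c] at h ⊢
    apply key
    · have := h.1; rw [Zsqrtd.re_mul] at this; push_cast at this; exact this
    · have := h.2; rw [Zsqrtd.im_mul] at this; push_cast at this; exact this

theorem sqfree_decomp (x : O) (hx : x ≠ 0) : ∃ d w : O, Squarefree d ∧ x = d * (w * w) := by
  induction x using UniqueFactorizationMonoid.induction_on_prime with
  | h₁ => exact absurd rfl hx
  | h₂ x hu => exact ⟨x, 1, hu.squarefree, by ring⟩
  | h₃ a p ha hp ih =>
    obtain ⟨d, w, hd, rfl⟩ := ih ha
    by_cases h : p ∣ d
    · obtain ⟨d', rfl⟩ := h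
      exact ⟨d', p * w, hd.squarefree_of_dvd (dvd_mul_left _ _), by ring⟩
    · refine ⟨p * d, w, ?_, by ring⟩
      rw [squarefree_mul_iff]
      exact ⟨(hp.irreducible.isRelPrime_iff_not_dvd.2 h), hp.irreducible.squarefree, hd⟩

theorem sq_dvd {a b c : O} (hb : b ≠ 0) (h : a * a = b * b * c) : b ∣ a := by
  obtain ⟨b', a', g, hr, rfl, rfl⟩ := UniqueFactorizationMonoid.exists_reduced_factors b hb a
  have hg : g ≠ 0 := left_ne_zero_of_mul hb
  have h2 : a' * a' = b' * b' * c := by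
    have : (g * g) * (a' * a') = (g * g) * (b' * b' * c) := by linear_combination h
    exact mul_left_cancel₀ (mul_ne_zero hg hg) this
  have h3 : b' ∣ a' * a' := ⟨b' * c, by rw [h2]; ring⟩
  have h4 : b' ∣ a' := hr.dvd_of_dvd_mul_right h3
  exact mul_dvd_mul_left _ h4

theorem K_sq_int {y : K} {c : O} (h : y * y = io c) : ∃ z : O, y = io z := by
  obtain ⟨z, n, hn, rfl⟩ := K_frac y
  have hn' : (n : K) ≠ 0 := by exact_mod_cast hn
  have hno : (n : O) ≠ 0 := by exact_mod_cast hn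
  have : z * z = (n : O) * n * c := by
    apply io_inj
    simp only [map_mul, map_natCast]
    rw [← h]
    field_simp
  obtain ⟨w, rfl⟩ := sq_dvd hno this
  exact ⟨w, by simp only [map_mul, map_natCast]; field_simp⟩

theorem descG (A B : O) (X Y : K) (hX : X ≠ 0)
    (h : Y ^ 2 = X * (X ^ 2 + io A * X + io B)) :
    ∃ d M e g B' : O, e ≠ 0 ∧ M ≠ 0 ∧ IsRelPrime M e ∧ Squarefree d ∧ B = d * B' ∧
      X = io d * (io M / io e) ^ 2 ∧ g ^ 2 = d * M ^ 4 + A * M ^ 2 * e ^ 2 + B' * e ^ 4 := by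
  obtain ⟨P, n, hn, rfl⟩ := K_frac X
  have hn' : (n : K) ≠ 0 := by exact_mod_cast hn
  have hno : (n : O) ≠ 0 := by exact_mod_cast hn
  have hP : P ≠ 0 := by rintro rfl; simp at hX
  obtain ⟨d, w, hd, hdw⟩ := sqfree_decomp (P * n) (mul_ne_zero hP hno)
  have hw : w ≠ 0 := by
    rintro rfl
    exact mul_ne_zero hP hno (by rw [hdw]; ring)
  have hd0 : d ≠ 0 := by
    rintro rfl
    exact mul_ne_zero hP hno (by rw [hdw]; ring)
  obtain ⟨M, e, c, hr, hcM, hce⟩ := UniqueFactorizationMonoid.exists_reduced_factors w hw (n : O)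
  have hM : M ≠ 0 := by rintro rfl; exact hw (by rw [← hcM]; ring)
  have he : e ≠ 0 := by rintro rfl; exact hno (by rw [← hce]; ring)
  have hc : c ≠ 0 := by rintro rfl; exact hno (by rw [← hce]; ring)
  have iM : io M ≠ 0 := fun h => hM (io_eq_zero.1 h)
  have ie : io e ≠ 0 := fun h => he (io_eq_zero.1 h)
  have ic : io c ≠ 0 := fun h => hc (io_eq_zero.1 h)
  have idd : io d ≠ 0 := fun h => hd0 (io_eq_zero.1 h)
  have hXe : io P / (n : K) = io d * (io M / io e) ^ 2 := by
    have h1 : (n : K) = io c * io e := by rw [← map_mul, hce]; simp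
    have h2 : io P * (io c * io e) = io d * (io c * io M) ^ 2 := by
      rw [← h1, ← map_mul, hcM, pow_two, ← map_mul, ← map_mul, ← hdw]; simp
    rw [h1]
    field_simp
    field_simp at h2
    linear_combination h2
  rw [hXe] at h ⊢
  obtain ⟨g0, hg0⟩ : ∃ g0 : O, Y * io e ^ 3 / io M = io g0 := by
    apply K_sq_int (c := d * (d ^ 2 * M ^ 4 + A * d * M ^ 2 * e ^ 2 + B * e ^ 4))
    have : Y * io e ^ 3 / io M * (Y * io e ^ 3 / io M) = Y ^ 2 * io e ^ 6 / io M ^ 2 := by ring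
    rw [this, h]
    simp only [map_mul, map_add, map_pow]
    field_simp
  have hg1 : g0 ^ 2 = d * (d ^ 2 * M ^ 4 + A * d * M ^ 2 * e ^ 2 + B * e ^ 4) := by
    apply io_inj
    rw [map_pow, ← hg0]
    have : (Y * io e ^ 3 / io M) ^ 2 = Y ^ 2 * io e ^ 6 / io M ^ 2 := by ring
    rw [this, h]
    simp only [map_mul, map_add, map_pow]
    field_simp
  have hdg : d ∣ g0 := hd.isRadical 2 g0 ⟨_, hg1⟩
  obtain ⟨g, rfl⟩ := hdg
  have hg2 : d * g ^ 2 = d ^ 2 * M ^ 4 + A * d * M ^ 2 * e ^ 2 + B * e ^ 4 := by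
    apply mul_left_cancel₀ hd0
    rw [← hg1]; ring
  have hde : IsRelPrime d e := by
    apply UniqueFactorizationMonoid.isRelPrime_iff_no_prime_factors hd0 |>.2
    intro p hpd hpe hp
    obtain ⟨d', rfl⟩ := hpd
    obtain ⟨f, rfl⟩ := hpe
    have hpd' : ¬ p ∣ d' := by
      rintro ⟨k, rfl⟩
      exact hp.not_isUnit (hd p ⟨k, by ring⟩)
    have hpM : ¬ p ∣ M := fun hh => hp.not_isUnit (hr hh (dvd_mul_right _ _))
    have h3 : d' * g ^ 2 = p * (d' ^ 2 * M ^ 4 + A * p * d' * M ^ 2 * f ^ 2 + B * p ^ 2 * f ^ 4) := by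
      apply mul_left_cancel₀ hp.ne_zero
      linear_combination hg2
    have hpg : p ∣ g := by
      rcases hp.dvd_or_dvd (Dvd.intro _ h3.symm) with h4 | h4
      · exact absurd h4 hpd'
      · exact hp.dvd_of_dvd_pow h4
    obtain ⟨k, rfl⟩ := hpg
    have h5 : d' ^ 2 * M ^ 4 = p * (d' * k ^ 2 - A * d' * M ^ 2 * f ^ 2 - B * p * f ^ 4) := by
      apply mul_left_cancel₀ hp.ne_zero
      linear_combination -h3
    rcases hp.dvd_or_dvd (Dvd.intro _ h5.symm) with h4 | h4
    · exact hpd' (hp.dvd_of_dvd_pow h4)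
    · exact hpM (hp.dvd_of_dvd_pow h4)
  have hdB : d ∣ B * e ^ 4 := ⟨g ^ 2 - d * M ^ 4 - A * M ^ 2 * e ^ 2, by linear_combination -hg2⟩
  have hdB2 : d ∣ B := (IsRelPrime.pow_right hde).dvd_of_dvd_mul_right hdB
  obtain ⟨B', rfl⟩ := hdB2
  refine ⟨d, M, e, g, B', he, hM, hr, hd, rfl, rfl, ?_⟩
  apply mul_left_cancel₀ hd0
  rw [hg2]; ring

end EC

namespace EC

def Sol (A B d : O) (X : K) : Prop := ∃ M e g B' : O, e ≠ 0 ∧ IsRelPrime M e ∧ B = d * B' ∧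
      X = io d * (io M / io e) ^ 2 ∧ g ^ 2 = d * M ^ 4 + A * M ^ 2 * e ^ 2 + B' * e ^ 4

theorem Sol_unit {A B d u : O} {X : K} (hu : IsUnit u) (h : Sol A B (d * (u * u)) X) : Sol A B d X := by
  obtain ⟨M, e, g, B', he, hr, hB, hX, hg⟩ := h
  refine ⟨u * M, e, u * g, u * u * B', he, ?_, by rw [hB]; ring, ?_, ?_⟩
  · exact (isRelPrime_mul_unit_left_left hu).2 hr
  · rw [hX]; simp only [map_mul]; ring
  · linear_combination u ^ 2 * hg

theorem Sol.mulD {A B d : O} {X : K} (h : Sol A B d X) : ∃ M e g : O, e ≠ 0 ∧ IsRelPrime M e ∧ 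
    X = io d * (io M / io e) ^ 2 ∧ d * g ^ 2 = d ^ 2 * M ^ 4 + d * A * M ^ 2 * e ^ 2 + B * e ^ 4 := by
  obtain ⟨M, e, g, B', he, hr, hB, hX, hg⟩ := h
  exact ⟨M, e, g, he, hr, hX, by rw [hB]; linear_combination d * hg⟩

theorem dvd_prime_mul {p d m : O} (hp : Prime p) (h : d ∣ p * m) : d ∣ m ∨ ∃ d', d = p * d' ∧ d' ∣ m := by
  by_cases hpd : p ∣ d
  · obtain ⟨d', rfl⟩ := hpd
    exact Or.inr ⟨d', rfl, (mul_dvd_mul_iff_left hp.ne_zero).1 h⟩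
  · exact Or.inl ((hp.irreducible.isRelPrime_iff_not_dvd.2 hpd).symm.dvd_of_dvd_mul_left h)

theorem descS (A B : O) (X Y : K) (hX : X ≠ 0)
    (h : Y ^ 2 = X * (X ^ 2 + io A * X + io B)) : ∃ d, Squarefree d ∧ d ∣ B ∧ Sol A B d X := by
  obtain ⟨d, M, e, g, B', he, hM, hr, hd, hB, hX, hg⟩ := descG A B X Y hX h
  exact ⟨d, hd, ⟨B', hB⟩, M, e, g, B', he, hr, hB, hX, hg⟩

/-! arithmetic modulo 3 -/
def mul3 (x y : ZMod 3 × ZMod 3) : ZMod 3 × ZMod 3 := (x.1 * y.1 + 2 * x.2 * y.2, x.1 * y.2 + x.2 * y.1)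
def r3 (z : O) : ZMod 3 × ZMod 3 := ((z.re : ZMod 3), (z.im : ZMod 3))

theorem r3_mul (x y : O) : r3 (x * y) = mul3 (r3 x) (r3 y) := by
  simp [r3, mul3, Zsqrtd.re_mul, Zsqrtd.im_mul]
theorem r3_add (x y : O) : r3 (x + y) = r3 x + r3 y := by
  simp [r3]
theorem r3_zero {z : O} (h : r3 z = 0) : (3 : O) ∣ z := by
  rw [three_dvd]
  have h1 : (z.re : ZMod 3) = 0 := congrArg Prod.fst h
  have h2 : (z.im : ZMod 3) = 0 := congrArg Prod.snd h
  exact ⟨(ZMod.intCast_zmod_eq_zero_iff_dvd _ 3).1 h1, (ZMod.intCast_zmod_eq_zero_iff_dvd _ 3).1 h2⟩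

theorem mod3_key : ∀ M e g : ZMod 3 × ZMod 3,
    (mul3 (1, 1) (mul3 g g) = mul3 (mul3 (1,1) (1,1)) (mul3 (mul3 M M) (mul3 M M)) +
      mul3 (1, 1) (mul3 (mul3 M M) (mul3 e e)) + (mul3 (mul3 e e) (mul3 e e)) ∨
    mul3 (2, 2) (mul3 g g) = mul3 (mul3 (2,2) (2,2)) (mul3 (mul3 M M) (mul3 M M)) +
      mul3 (2, 2) (mul3 (mul3 M M) (mul3 e e)) + (mul3 (mul3 e e) (mul3 e e))) → M = 0 ∧ e = 0 := by
  decide +kernel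

def Ao : O := 5 * so * alo
def Bo : O := - alo ^ 2

theorem excl_ep {X : K} {c : O} (hc : c = ep ∨ c = -ep) (h : Sol Ao Bo c X) : False := by
  obtain ⟨M, e, g, he, hr, -, hg⟩ := h.mulD
  have h1 := congrArg r3 hg
  have h2 : r3 (c * g ^ 2) = mul3 (r3 c) (mul3 (r3 g) (r3 g)) := by rw [pow_two, r3_mul, r3_mul]
  have h3 : r3 (c ^ 2 * M ^ 4 + c * Ao * M ^ 2 * e ^ 2 + Bo * e ^ 4) =
      mul3 (mul3 (r3 c) (r3 c)) (mul3 (mul3 (r3 M) (r3 M)) (mul3 (r3 M) (r3 M))) + 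
      mul3 (r3 c) (mul3 (r3 Ao) (mul3 (mul3 (r3 M) (r3 M)) (mul3 (r3 e) (r3 e)))) +
      mul3 (r3 Bo) (mul3 (mul3 (r3 e) (r3 e)) (mul3 (r3 e) (r3 e))) := by
    simp only [← r3_mul, ← r3_add]
    congr 1; ring
  have hA : r3 Ao = (1, 0) := by decide +kernel
  have hB : r3 Bo = (1, 0) := by decide +kernel
  have hm : ∀ x, mul3 (1, 0) x = x := by decide +kernel
  rw [h2, h3, hA, hB, hm, hm] at h1
  have hk := mod3_key (r3 M) (r3 e) (r3 g) (by
    rcases hc with rfl | rfl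
    · left; exact h1
    · right; exact h1)
  exact prime_three.not_isUnit (hr (r3_zero hk.1) (r3_zero hk.2))

theorem flt {x : ZMod 409} (hx : x ≠ 0) : (x ^ 2) ^ 204 = 1 := by
  rw [← pow_mul]
  exact ZMod.pow_card_sub_one_eq_one hx

theorem nr_key {c x y : ZMod 409} (hc : c ^ 204 = -1) (h : x ^ 2 = c * y ^ 2) : y = 0 := by
  by_contra hy
  have hc0 : c ≠ 0 := by rintro rfl; revert hc; decide +kernel
  have hx : x ≠ 0 := by
    rintro rfl
    rw [zero_pow two_ne_zero, eq_comm, mul_eq_zero] at h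
    rcases h with h | h
    · exact hc0 h
    · exact hy (pow_eq_zero_iff two_ne_zero |>.1 h)
  have := congrArg (· ^ 204) h
  simp only [mul_pow] at this
  rw [flt hx, flt hy, hc] at this
  revert this; decide +kernel

theorem nr_key2 {c x y r1 r2 A B : ZMod 409} (hc : c ^ 204 = 1) (h1 : r1 ^ 204 = -1) (h2 : r2 ^ 204 = -1)
    (hA : A = -(r1 + r2)) (hB : B = r1 * r2) (h : (c * x ^ 2) ^ 2 + A * (c * x ^ 2) * y ^ 2 + B * y ^ 4 = 0) :
    x = 0 ∧ y = 0 := by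
  have hc0 : c ≠ 0 := by rintro rfl; revert hc; decide +kernel
  have hcs : ∀ r : ZMod 409, r ^ 204 = -1 → c * x ^ 2 = r * y ^ 2 → y = 0 := by
    intro r hr hh
    by_contra hy
    by_cases hx : x = 0
    · subst hx
      have hr0 : r ≠ 0 := by rintro rfl; revert hr; decide +kernel
      rw [zero_pow two_ne_zero, mul_zero, eq_comm, mul_eq_zero] at hh
      rcases hh with h | h
      · exact hr0 h
      · exact hy (pow_eq_zero_iff two_ne_zero |>.1 h)
    · have := congrArg (· ^ 204) hh
      simp only [mul_pow] at this
      rw [flt hx, flt hy, hc, hr] at this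
      revert this; decide +kernel
  have hy : y = 0 := by
    have : (c * x ^ 2 - r1 * y ^ 2) * (c * x ^ 2 - r2 * y ^ 2) = 0 := by
      rw [hA, hB] at h
      linear_combination h
    rcases mul_eq_zero.1 this with h | h
    · exact hcs r1 h1 (sub_eq_zero.1 h)
    · exact hcs r2 h2 (sub_eq_zero.1 h)
  refine ⟨?_, hy⟩
  subst hy
  have : (c * x ^ 2) ^ 2 = 0 := by linear_combination h
  have := pow_eq_zero_iff two_ne_zero |>.1 this
  rcases mul_eq_zero.1 this with h | h
  · exact absurd h hc0
  · exact pow_eq_zero_iff two_ne_zero |>.1 h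

theorem excl_al {X : K} {c : O} (hc : f9 c ^ 204 = 1) (h : Sol Ao Bo (alo * c) X) : False := by
  obtain ⟨M, e, g, he, hr, -, hg⟩ := h.mulD
  have h1 : c * g ^ 2 = alo * (c ^ 2 * M ^ 4 + 5 * so * c * M ^ 2 * e ^ 2 - e ^ 4) := by
    apply mul_left_cancel₀ prime_alo.ne_zero
    rw [Ao, Bo] at hg
    linear_combination hg
  have hc0 : ¬ alo ∣ c := by
    rw [← f9_eq_zero]
    intro h; rw [h] at hc; revert hc; decide +kernel
  have hag : alo ∣ g := by
    rcases prime_alo.dvd_or_dvd (Dvd.intro _ h1.symm) with h4 | h4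
    · exact absurd h4 hc0
    · exact prime_alo.dvd_of_dvd_pow h4
  obtain ⟨k, rfl⟩ := hag
  have h2 : c * alo * k ^ 2 = c ^ 2 * M ^ 4 + 5 * so * c * M ^ 2 * e ^ 2 - e ^ 4 := by
    apply mul_left_cancel₀ prime_alo.ne_zero
    linear_combination h1
  have h3 := congrArg f9 h2
  simp only [map_mul, map_add, map_sub, map_pow, f9_alo, map_ofNat] at h3
  have h4 := nr_key2 (c := f9 c) (x := f9 M) (y := f9 e) (r1 := 58) (r2 := 275) (A := 5 * f9 so) (B := -1)
    hc (by decide +kernel) (by decide +kernel) (by decide +kernel) (by decide +kernel) (by linear_combination -h3)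
  exact prime_alo.not_isUnit (hr (alo_dvd h4.1) (alo_dvd h4.2))

theorem D1 (X Y : K) (hX : X ≠ 0)
    (h : Y ^ 2 = X * (X ^ 2 + 5 * sq2 * (21 + 4 * sq2) * X - (21 + 4 * sq2) ^ 2)) :
    ∃ w : K, X = w ^ 2 ∨ X = - w ^ 2 := by
  obtain ⟨d, hd, hdB, hS⟩ := descS Ao Bo X Y hX (by
    rw [h, Ao, Bo]; simp only [map_mul, map_neg, map_pow, map_ofNat, io_so, io_alo]; ring)
  have h1 : d ∣ alo * 1 := by
    rw [mul_one]
    apply hd.isRadical 2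
    rw [Bo] at hdB
    exact (dvd_neg).1 hdB
  have hcl : ∀ c : O, (c = 1 ∨ c = -1 ∨ c = ep ∨ c = -ep) → f9 c ^ 204 = 1 := by
    rintro c (rfl | rfl | rfl | rfl)
    · simp
    · decide +kernel
    · decide +kernel
    · decide +kernel
  rcases dvd_prime_mul prime_alo h1 with h2 | ⟨d', rfl, h2⟩
  · obtain ⟨c, u, hu, rfl, hc⟩ := unit_class d (isUnit_of_dvd_one h2)
    have hS := Sol_unit hu hS
    rcases hc with rfl | rfl | hc
    · obtain ⟨M, e, g, he, hr, hX, -⟩ := hS.mulD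
      exact ⟨_, Or.inl (by rw [hX, map_one, one_mul])⟩
    · obtain ⟨M, e, g, he, hr, hX, -⟩ := hS.mulD
      exact ⟨_, Or.inr (by rw [hX, map_neg, map_one, neg_one_mul])⟩
    · exact (excl_ep hc hS).elim
  · obtain ⟨c, u, hu, rfl, hc⟩ := unit_class d' (isUnit_of_dvd_one h2)
    rw [← mul_assoc] at hS
    exact (excl_al (hcl c hc) (Sol_unit hu hS)).elim

/-! second descent -/
def Ao2 : O := -10 * so * alo
def Bo2 : O := 54 * alo ^ 2

theorem pos_real (φ : O →+* ℝ) (hφ : φ so ^ 2 = 2) {d M e g : O} (he : e ≠ 0)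
    (hg : d * g ^ 2 = d ^ 2 * M ^ 4 + d * Ao2 * M ^ 2 * e ^ 2 + Bo2 * e ^ 4) (hinj : Function.Injective φ) : 0 < φ d := by
  have h := congrArg φ hg
  rw [Ao2, Bo2] at h
  simp only [map_mul, map_add, map_pow, map_neg, map_ofNat] at h
  have he' : φ e ≠ 0 := fun hh => he (hinj (by rw [hh, map_zero]))
  have ha' : φ alo ≠ 0 := fun hh => prime_alo.ne_zero (hinj (by rw [hh, map_zero]))
  have hpos : 0 < φ d * φ g ^ 2 := by
    rw [h]
    have : φ d ^ 2 * φ M ^ 4 + φ d * (-10 * φ so * φ alo) * φ M ^ 2 * φ e ^ 2 + 54 * φ alo ^ 2 * φ e ^ 4 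
      = (φ d * φ M ^ 2 - 5 * φ so * φ alo * φ e ^ 2) ^ 2 + 4 * (φ alo * φ e ^ 2) ^ 2 := by
      linear_combination (-25 * φ alo ^ 2 * φ e ^ 4) * hφ
    rw [this]
    positivity
  by_contra hneg
  have := mul_nonneg (sub_nonneg.2 (not_lt.1 hneg)) (sq_nonneg (φ g))
  nlinarith

noncomputable def r1 : O →+* ℝ := Zsqrtd.lift ⟨Real.sqrt 2, by simp⟩
noncomputable def r2 : O →+* ℝ := Zsqrtd.lift ⟨-Real.sqrt 2, by simp⟩

theorem r1_def (z : O) : r1 z = z.re + z.im * Real.sqrt 2 := rfl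
theorem r2_def (z : O) : r2 z = z.re + z.im * -Real.sqrt 2 := rfl

theorem r1_inj : Function.Injective r1 := by
  rw [injective_iff_map_eq_zero]
  intro z hz
  rw [r1_def] at hz
  have := K_uniq z.re z.im (by apply Subtype.ext; simpa [sq2] using hz)
  ext
  · exact_mod_cast this.1
  · exact_mod_cast this.2

theorem r2_inj : Function.Injective r2 := by
  rw [injective_iff_map_eq_zero]
  intro z hz
  rw [r2_def] at hz
  have := K_uniq z.re (-z.im) (by apply Subtype.ext; simpa [sq2] using hz)
  ext
  · exact_mod_cast this.1
  · have := this.2; rw [neg_eq_zero] at this; exact_mod_cast this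

theorem Sol_pos {d : O} {X : K} (h : Sol Ao2 Bo2 d X) : 0 < r1 d ∧ 0 < r2 d := by
  obtain ⟨M, e, g, he, hr, -, hg⟩ := h.mulD
  exact ⟨pos_real r1 (by simp [r1_def, so]) he hg r1_inj, pos_real r2 (by simp [r2_def, so]) he hg r2_inj⟩

theorem excl_nr {X : K} {d : O} (hd : f9 d ^ 204 = -1) (h : Sol Ao2 Bo2 d X) : False := by
  obtain ⟨M, e, g, he, hr, -, hg⟩ := h.mulD
  have hd0 : f9 d ≠ 0 := by rintro h; rw [h] at hd; revert hd; decide +kernel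
  have h1 := congrArg f9 hg
  simp only [Ao2, Bo2, map_mul, map_add, map_pow, map_neg, f9_alo, map_ofNat] at h1
  have h2 : f9 g ^ 2 = f9 d * (f9 M ^ 2) ^ 2 := by
    apply mul_left_cancel₀ hd0
    rw [h1]; ring
  have hM : f9 M = 0 := pow_eq_zero_iff two_ne_zero |>.1 (nr_key hd h2)
  have hG : f9 g = 0 := by
    rw [hM] at h2
    exact pow_eq_zero_iff two_ne_zero |>.1 (by rw [h2]; ring)
  obtain ⟨m, rfl⟩ := alo_dvd hM
  obtain ⟨k, rfl⟩ := alo_dvd hG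
  have h3 : d * k ^ 2 = alo * (d ^ 2 * alo * m ^ 4 + d * (-10 * so) * m ^ 2 * e ^ 2) + 54 * e ^ 4 := by
    apply mul_left_cancel₀ (pow_ne_zero 2 prime_alo.ne_zero)
    rw [Ao2, Bo2] at hg
    linear_combination hg
  have h4 := congrArg f9 h3
  simp only [map_mul, map_add, map_pow, f9_alo, zero_mul, zero_add, map_ofNat] at h4
  have h5 : (f9 d * f9 k) ^ 2 = (54 * f9 d) * (f9 e ^ 2) ^ 2 := by linear_combination f9 d * h4
  have h6 := nr_key (by rw [mul_pow, hd]; decide +kernel) h5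
  have hE : f9 e = 0 := pow_eq_zero_iff two_ne_zero |>.1 h6
  exact prime_alo.not_isUnit (hr (dvd_mul_right _ _) (alo_dvd hE))

theorem excl_al2 {X : K} {c : O} (hc : f9 c ^ 204 = 1) (h : Sol Ao2 Bo2 (alo * c) X) : False := by
  obtain ⟨M, e, g, he, hr, -, hg⟩ := h.mulD
  have h1 : c * g ^ 2 = alo * (c ^ 2 * M ^ 4 - 10 * so * c * M ^ 2 * e ^ 2 + 54 * e ^ 4) := by
    apply mul_left_cancel₀ prime_alo.ne_zero
    rw [Ao2, Bo2] at hg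
    linear_combination hg
  have hc0 : ¬ alo ∣ c := by
    rw [← f9_eq_zero]
    intro h; rw [h] at hc; revert hc; decide +kernel
  have hag : alo ∣ g := by
    rcases prime_alo.dvd_or_dvd (Dvd.intro _ h1.symm) with h4 | h4
    · exact absurd h4 hc0
    · exact prime_alo.dvd_of_dvd_pow h4
  obtain ⟨k, rfl⟩ := hag
  have h2 : c * alo * k ^ 2 = c ^ 2 * M ^ 4 - 10 * so * c * M ^ 2 * e ^ 2 + 54 * e ^ 4 := by
    apply mul_left_cancel₀ prime_alo.ne_zero
    linear_combination h1
  have h3 := congrArg f9 h2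
  simp only [map_mul, map_add, map_sub, map_pow, f9_alo, map_ofNat] at h3
  have h4 := nr_key2 (c := f9 c) (x := f9 M) (y := f9 e) (r1 := 199) (r2 := 362) (A := -10 * f9 so) (B := 54)
    hc (by decide +kernel) (by decide +kernel) (by decide +kernel) (by decide +kernel) (by linear_combination -h3)
  exact prime_alo.not_isUnit (hr (alo_dvd h4.1) (alo_dvd h4.2))

theorem Sol_X {A B d : O} {X : K} (h : Sol A B d X) : ∃ w : K, X = io d * w ^ 2 := by
  obtain ⟨M, e, g, he, hr, hX, hg⟩ := h.mulD
  exact ⟨_, hX⟩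

theorem D2 (U V : K) (hU : U ≠ 0)
    (h : V ^ 2 = U * (U ^ 2 - 10 * sq2 * (21 + 4 * sq2) * U + 54 * (21 + 4 * sq2) ^ 2)) :
    ∃ w : K, U = w ^ 2 ∨ U = 3 * w ^ 2 ∨ U = (2 + sq2) * (21 + 4 * sq2) * w ^ 2 ∨
      U = 3 * ((2 + sq2) * (21 + 4 * sq2) * w ^ 2) := by
  obtain ⟨d, hd, hdB, hS⟩ := descS Ao2 Bo2 U V hU (by
    rw [h, Ao2, Bo2]; simp only [map_mul, map_neg, map_pow, map_ofNat, io_so, io_alo]; ring)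
  have h1 : d ∣ alo * (3 * (so * 1)) := by
    apply hd.isRadical 3
    exact hdB.trans ⟨alo * so, by rw [Bo2]; linear_combination (27 * alo ^ 3 * so) * so_sq⟩
  obtain ⟨m, d1, hd1, hm, hS1⟩ : ∃ m d1 : O, IsUnit d1 ∧ (m = 1 ∨ m = so ∨ m = 3 ∨ m = 3 * so ∨ m = alo ∨ m = alo * so ∨ m = alo * 3 ∨ m = alo * (3 * so)) ∧ d = m * d1 := by
    rcases dvd_prime_mul prime_alo h1 with h2 | ⟨d, rfl, h2⟩ <;>
    rcases dvd_prime_mul prime_three h2 with h3 | ⟨d, rfl, h3⟩ <;>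
    rcases dvd_prime_mul prime_so h3 with h4 | ⟨d, rfl, h4⟩
    · exact ⟨1, d, isUnit_of_dvd_one h4, by simp, by ring⟩
    · exact ⟨so, d, isUnit_of_dvd_one h4, by simp, by ring⟩
    · exact ⟨3, d, isUnit_of_dvd_one h4, by simp, by ring⟩
    · exact ⟨3 * so, d, isUnit_of_dvd_one h4, by simp, by ring⟩
    · exact ⟨alo, d, isUnit_of_dvd_one h4, by simp, by ring⟩
    · exact ⟨alo * so, d, isUnit_of_dvd_one h4, by simp, by ring⟩
    · exact ⟨alo * 3, d, isUnit_of_dvd_one h4, by simp, by ring⟩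
    · exact ⟨alo * (3 * so), d, isUnit_of_dvd_one h4, by simp, by ring⟩
  subst hS1
  obtain ⟨c, u, hu, rfl, hc⟩ := unit_class d1 hd1
  rw [← mul_assoc] at hS
  have hS := Sol_unit hu hS
  obtain ⟨p1, p2⟩ := Sol_pos hS
  rw [map_mul] at p1 p2
  have q1 : 1 < Real.sqrt 2 := by
    rw [Real.lt_sqrt] <;> norm_num
  have q2 : Real.sqrt 2 < 2 := by
    rw [Real.sqrt_lt] <;> norm_num
  have e1 : r1 ep = 1 + Real.sqrt 2 := by simp [r1_def, ep]
  have e2 : r2 ep = 1 - Real.sqrt 2 := by simp [r2_def, ep]; ring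
  have s1 : r1 so = Real.sqrt 2 := by simp [r1_def, so]
  have s2 : r2 so = -Real.sqrt 2 := by simp [r2_def, so]
  have a1 : r1 alo = 21 + 4 * Real.sqrt 2 := by simp [r1_def, alo]
  have a2 : 0 < r2 alo := by simp [r2_def, alo]; linarith
  have mp1 : 0 < r1 m := by
    rcases hm with rfl | rfl | rfl | rfl | rfl | rfl | rfl | rfl <;> simp only [map_mul, map_one, map_ofNat, s1, a1] <;> positivity
  have cp1 : 0 < r1 c := (mul_pos_iff_of_pos_left mp1).1 p1
  have hc' : c = 1 ∨ c = ep := by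
    rcases hc with h | h | h | h
    · exact Or.inl h
    · rw [h, map_neg, map_one] at cp1; linarith
    · exact Or.inr h
    · rw [h, map_neg, e1] at cp1; linarith
  have hfin : m * c = 1 ∨ m * c = 3 ∨ m * c = alo * 1 ∨ m * c = alo * 3 ∨ m * c = so * ep ∨ m * c = 3 * so * ep
      ∨ m * c = alo * (so * ep) ∨ m * c = alo * (3 * so * ep) := by
    have n1 : ∀ m : O, 0 < r2 m → 0 < r2 m * r2 ep → False := by
      intro m h1 h2
      rw [e2] at h2
      have := (mul_pos_iff_of_pos_left h1).1 h2
      linarith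
    have n2 : ∀ m : O, 0 < r2 m → 0 < r2 (m * so) → False := by
      intro m h1 h2
      rw [map_mul, s2] at h2
      have := (mul_pos_iff_of_pos_left h1).1 h2
      linarith
    have t1 : 0 < r2 1 := by simp
    have t3 : 0 < r2 3 := by rw [map_ofNat]; norm_num
    have ta3 : 0 < r2 (alo * 3) := by rw [map_mul]; exact mul_pos a2 t3
    rcases hc' with rfl | rfl
    · rw [map_one, mul_one] at p2
      rw [mul_one]
      rcases hm with rfl | rfl | rfl | rfl | rfl | rfl | rfl | rfl
      · simp
      · exact (n2 1 t1 (by rwa [one_mul])).elim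
      · simp
      · exact (n2 3 t3 p2).elim
      · simp
      · exact (n2 alo a2 p2).elim
      · simp
      · exact (n2 (alo * 3) ta3 (by rwa [mul_assoc])).elim
    · rcases hm with rfl | rfl | rfl | rfl | rfl | rfl | rfl | rfl
      · exact (n1 _ t1 p2).elim
      · simp
      · exact (n1 _ t3 p2).elim
      · simp
      · exact (n1 _ a2 p2).elim
      · simp [mul_assoc]
      · exact (n1 _ ta3 p2).elim
      · simp [mul_assoc]
  have ie : io ep = 1 + sq2 := by rw [ep_eq, map_add, map_one, io_so]
  rcases hfin with h | h | h | h | h | h | h | h <;> rw [h] at hS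
  · obtain ⟨w, hw⟩ := Sol_X hS
    exact ⟨w, Or.inl (by rw [hw]; simp)⟩
  · obtain ⟨w, hw⟩ := Sol_X hS
    exact ⟨w, Or.inr (Or.inl (by rw [hw, map_ofNat]))⟩
  · exact (excl_al2 (by simp) hS).elim
  · exact (excl_al2 (by decide +kernel) hS).elim
  · exact (excl_nr (by decide +kernel) hS).elim
  · exact (excl_nr (by decide +kernel) hS).elim
  · obtain ⟨w, hw⟩ := Sol_X hS
    refine ⟨w, Or.inr (Or.inr (Or.inl ?_))⟩
    rw [hw]; simp only [map_mul, ie, io_so, io_alo]; linear_combination ((21 + 4 * sq2) * w ^ 2) * s_sq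
  · obtain ⟨w, hw⟩ := Sol_X hS
    refine ⟨w, Or.inr (Or.inr (Or.inr ?_))⟩
    rw [hw]; simp only [map_mul, ie, io_so, io_alo, map_ofNat]; linear_combination (3 * (21 + 4 * sq2) * w ^ 2) * s_sq

end EC

namespace EC

section generic
set_option linter.unusedSectionVars false
variable {F : Type*} [Field F] [DecidableEq F]

/-- the curve `y² = x³ + a x² + b x` -/
abbrev Wc (a b : F) : WeierstrassCurve.Affine F := ⟨0, a, 0, b, 0⟩

open WeierstrassCurve WeierstrassCurve.Affine

variable {a b : F}

theorem eqn_iff (x y : F) : (Wc a b).Equation x y ↔ y ^ 2 = x ^ 3 + a * x ^ 2 + b * x := by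
  rw [WeierstrassCurve.Affine.equation_iff]
  simp

theorem pt_eqn {x y : F} (h : (Wc a b).Nonsingular x y) : y ^ 2 = x ^ 3 + a * x ^ 2 + b * x :=
  (eqn_iff x y).1 h.1

theorem negY_eq (x y : F) : (Wc a b).negY x y = -y := by
  simp [WeierstrassCurve.Affine.negY]

variable [(Wc a b).IsElliptic]

theorem nons {x y : F} (h : y ^ 2 = x ^ 3 + a * x ^ 2 + b * x) : (Wc a b).Nonsingular x y := by
  rw [← WeierstrassCurve.Affine.equation_iff_nonsingular]
  exact (eqn_iff x y).2 h

theorem some_congr {x y x' y' : F} {h : (Wc a b).Nonsingular x y} {h' : (Wc a b).Nonsingular x' y'}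
    (hx : x = x') (hy : y = y') : Point.some x y h = Point.some x' y' h' := by
  subst hx hy; rfl

theorem add_vieta {x1 y1 x2 y2 : F} {h1 : (Wc a b).Nonsingular x1 y1} {h2 : (Wc a b).Nonsingular x2 y2}
    (h : ¬ (x1 = x2 ∧ y1 = -y2)) : ∃ (l m x3 y3 : F) (h3 : (Wc a b).Nonsingular x3 y3),
      Point.some x1 y1 h1 + Point.some x2 y2 h2 = Point.some x3 y3 h3 ∧
      y1 = l * x1 + m ∧ y2 = l * x2 + m ∧ y3 = - (l * x3 + m) ∧ x1 + x2 + x3 = l ^ 2 - a ∧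
      x1 * x2 + x1 * x3 + x2 * x3 = b - 2 * l * m ∧ x1 * x2 * x3 = m ^ 2 := by
  have h' : ¬ (x1 = x2 ∧ y1 = (Wc a b).negY x2 y2) := by rwa [negY_eq]
  obtain ⟨l, hl⟩ : ∃ l, l = (Wc a b).slope x1 x2 y1 y2 := ⟨_, rfl⟩
  have e1 := pt_eqn h1
  have e2 := pt_eqn h2
  have key : y2 = l * x2 + (y1 - l * x1) ∧ 
    x1 * x2 + x1 * (l ^ 2 - a - x1 - x2) + x2 * (l ^ 2 - a - x1 - x2) = b - 2 * l * (y1 - l * x1) := by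
    by_cases hx : x1 = x2
    · have hy : y1 ≠ (Wc a b).negY x2 y2 := fun hh => h' ⟨hx, hh⟩
      have hyy : y1 = y2 := Y_eq_of_Y_ne h1.1 h2.1 hx hy
      rw [slope_of_Y_ne hx hy, negY_eq] at hl
      rw [negY_eq] at hy
      subst hx hyy
      have hy' : y1 - -y1 ≠ 0 := by
        intro hh; exact hy (by linear_combination hh)
      simp only at hl
      rw [eq_div_iff hy'] at hl
      exact ⟨by ring, by linear_combination hl⟩
    · rw [slope_of_X_ne hx, eq_div_iff (sub_ne_zero.2 hx)] at hl
      refine ⟨by linear_combination hl, ?_⟩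
      apply mul_left_cancel₀ (sub_ne_zero.2 hx)
      linear_combination e1 - e2 + (2 * y1 - l * (x1 - x2) - (y1 - y2)) * hl
  refine ⟨l, y1 - l * x1, l ^ 2 - a - x1 - x2, -(l * (l ^ 2 - a - x1 - x2) + (y1 - l * x1)), ?_, ?_, by ring, key.1, rfl, by ring, key.2, ?_⟩
  · have := nonsingular_add h1 h2 h'
    convert this using 1
    · rw [hl]; simp [addX]
    · rw [hl]; simp [addY, negAddY, addX, WeierstrassCurve.Affine.negY]; ring
  · rw [Point.add_some h']
    apply some_congr
    · rw [hl]; simp [addX]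
    · rw [hl]; simp [addY, negAddY, addX, WeierstrassCurve.Affine.negY]; ring
  · linear_combination -e1 + x1 * key.2

theorem add_opp {x1 y1 x2 y2 : F} {h1 : (Wc a b).Nonsingular x1 y1} {h2 : (Wc a b).Nonsingular x2 y2}
    (h : x1 = x2 ∧ y1 = -y2) : Point.some x1 y1 h1 + Point.some x2 y2 h2 = 0 := by
  apply Point.add_of_Y_eq h.1
  rw [negY_eq]; exact h.2

theorem neg_pt {x y : F} (h : (Wc a b).Nonsingular x y) (h' : (Wc a b).Nonsingular x (-y)) :
    - Point.some x y h = Point.some x (-y) h' := by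
  rw [Point.neg_some]
  exact some_congr rfl (negY_eq x y)

theorem nons_neg {x y : F} (h : (Wc a b).Nonsingular x y) : (Wc a b).Nonsingular x (-y) := by
  have := (nonsingular_neg (W' := Wc a b) x y).2 h
  rwa [negY_eq] at this

/-- `X - θ` is `q` times a square in `F[θ]/(θ²+aθ+b)` -/
def SqL (a b q X : F) : Prop := ∃ c d : F, X = q * (c ^ 2 - b * d ^ 2) ∧ -1 = q * (2 * c * d - a * d ^ 2)

theorem half {t Y : F} (hb : b ≠ 0) (h2 : (2 : F) ≠ 0) (ht : t ≠ 0) (h : (Wc a b).Nonsingular (t ^ 2) Y) (hs : SqL a b 1 (t ^ 2)) :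
    ∃ R : (Wc a b).Point, Point.some _ _ h = R + R := by
  obtain ⟨c, d, hc, hd⟩ := hs
  rw [one_mul] at hc hd
  obtain ⟨N, hN⟩ : ∃ N, N = c ^ 2 - a * c * d + b * d ^ 2 := ⟨_, rfl⟩
  have e := pt_eqn h
  have hN2 : N ^ 2 = t ^ 4 + a * t ^ 2 + b := by
    have : N ^ 2 = (c ^ 2 - b * d ^ 2) ^ 2 + (-a * (2 * c * d - a * d ^ 2)) * (c ^ 2 - b * d ^ 2) + b * (2 * c * d - a * d ^ 2) ^ 2 := by
      rw [hN]; ring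
    rw [this, ← hc, ← hd]; ring
  -- choose sign of t
  obtain ⟨t', ht', hY⟩ : ∃ t', t' ^ 2 = t ^ 2 ∧ Y = t' * N := by
    have : (Y - t * N) * (Y + t * N) = 0 := by linear_combination e - t ^ 2 * hN2
    rcases mul_eq_zero.1 this with h | h
    · exact ⟨t, rfl, by linear_combination h⟩
    · exact ⟨-t, by ring, by linear_combination h⟩
  have ht0 : t' ≠ 0 := by
    rintro rfl
    apply ht
    apply pow_eq_zero_iff two_ne_zero |>.1
    rw [← ht']; ring
  obtain ⟨w, hw⟩ : ∃ w, w = 2 * c - a * d := ⟨_, rfl⟩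
  have hw2 : w ^ 2 = 2 * t' ^ 2 + a + 2 * N := by
    rw [ht', hc, hN, hw]; linear_combination a * hd
  have hw0 : w ≠ 0 := by
    intro h0
    have : d * w = -1 := by rw [hw, hd]; ring
    rw [h0, mul_zero] at this
    exact neg_ne_zero.2 one_ne_zero this.symm
  obtain ⟨x, hx⟩ : ∃ x, x = t' ^ 2 + N + t' * w := ⟨_, rfl⟩
  have hxe : w ^ 2 * x = x ^ 2 + a * x + b := by
    rw [hx]; rw [← ht'] at hN2 hc
    have : t ^ 4 = t' ^ 4 := by linear_combination (-(t ^ 2) - t' ^ 2) * ht'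
    rw [this] at hN2
    linear_combination hN2 + (t' * w + N) * hw2
  have hx0 : x ≠ 0 := by
    rintro rfl
    apply hb; linear_combination -hxe
  have hpt : (Wc a b).Nonsingular x (w * x) := nons (by linear_combination x * hxe)
  refine ⟨Point.some x (w * x) hpt, ?_⟩
  have hyn : ¬ (x = x ∧ w * x = -(w * x)) := by
    rintro ⟨-, hh⟩
    have : 2 * (w * x) = 0 := by linear_combination hh
    rcases mul_eq_zero.1 this with h | h
    · exact h2 h
    · exact mul_ne_zero hw0 hx0 h
  obtain ⟨l, m, x3, y3, h3, hs, hy1, -, hy3, v1, v2, v3⟩ := add_vieta (h1 := hpt) (h2 := hpt) hyn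
  rw [hs]
  have hl : l = w + t' := by
    have : (2 * (w * x)) * (l - (w + t')) = 0 := by
      have hll : 2 * l * (w * x) = 3 * x ^ 2 + 2 * a * x + b := by
        linear_combination v2 - 2 * x * v1 + 2 * l * hy1
      linear_combination hll - hxe * 1 - x * hw2 + 2 * x * hx
    rcases mul_eq_zero.1 this with h | h
    · exact absurd h (mul_ne_zero h2 (mul_ne_zero hw0 hx0))
    · exact sub_eq_zero.1 h
  have hx3 : x3 = t' ^ 2 := by
    rw [hl] at v1
    linear_combination v1 + hw2 - 2 * hx
  apply some_congr
  · rw [hx3, ht']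
  · rw [hY, hy3, hx3, hl]
    rw [hl] at hy1
    linear_combination -hy1 - t' * hx

theorem SqL_mul {q x1 x2 x3 l m : F} (hq : q ≠ 0) (hns : ∀ z : F, z ^ 2 ≠ a ^ 2 - 4 * b) (h1 : SqL a b q x1) (h2 : SqL a b q x2)
    (v1 : x1 + x2 + x3 = l ^ 2 - a) (v2 : x1 * x2 + x1 * x3 + x2 * x3 = b - 2 * l * m)
    (v3 : x1 * x2 * x3 = m ^ 2) : SqL a b 1 x3 := by
  obtain ⟨c1, d1, hc1, hd1⟩ := h1
  obtain ⟨c2, d2, hc2, hd2⟩ := h2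
  have hN : ∀ c d : F, -1 = q * (2 * c * d - a * d ^ 2) → c ^ 2 - a * c * d + b * d ^ 2 ≠ 0 := by
    intro c d hd h0
    have hd0 : d ≠ 0 := by
      rintro rfl
      exact neg_ne_zero.2 (one_ne_zero (α := F)) (by rw [hd]; ring)
    apply hns ((2 * c - a * d) / d)
    field_simp
    linear_combination 4 * h0
  obtain ⟨N1, hN1⟩ : ∃ N, N = c1 ^ 2 - a * c1 * d1 + b * d1 ^ 2 := ⟨_, rfl⟩
  obtain ⟨N2, hN2⟩ : ∃ N, N = c2 ^ 2 - a * c2 * d2 + b * d2 ^ 2 := ⟨_, rfl⟩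
  have n1 : N1 ≠ 0 := by rw [hN1]; exact hN _ _ hd1
  have n2 : N2 ≠ 0 := by rw [hN2]; exact hN _ _ hd2
  let th : QuadraticAlgebra F (-b) (-a) := ⟨0, 1⟩
  let i : F →+* QuadraticAlgebra F (-b) (-a) := algebraMap F _
  have ire : ∀ x, (i x).re = x := fun x => rfl
  have iim : ∀ x, (i x).im = 0 := fun x => rfl
  have hth : th * th = - i a * th - i b := by
    ext <;> simp [th, ire, iim]
  have a1 : i x1 - th = i q * (i c1 + i d1 * th) ^ 2 := by
    have e1 := congrArg i hc1
    have e2 := congrArg i hd1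
    simp only [map_mul, map_sub, map_pow, map_neg, map_one, map_ofNat] at e1 e2
    linear_combination e1 + th * e2 - i q * i d1 ^ 2 * hth
  have a2 : i x2 - th = i q * (i c2 + i d2 * th) ^ 2 := by
    have e1 := congrArg i hc2
    have e2 := congrArg i hd2
    simp only [map_mul, map_sub, map_pow, map_neg, map_one, map_ofNat] at e1 e2
    linear_combination e1 + th * e2 - i q * i d2 ^ 2 * hth
  have a3 : (i x1 - th) * (i x2 - th) * (i x3 - th) = (i l * th + i m) ^ 2 := by
    have e1 := congrArg i v1
    have e2 := congrArg i v2
    have e3 := congrArg i v3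
    simp only [map_mul, map_sub, map_pow, map_add, map_ofNat] at e1 e2 e3
    linear_combination e3 - th * e2 + th ^ 2 * e1 - th * hth
  have b1 : (i c1 + i d1 * th) * (i c1 - i a * i d1 - i d1 * th) = i N1 := by
    have e1 := congrArg i hN1
    simp only [map_mul, map_sub, map_pow, map_add] at e1
    linear_combination -e1 - i d1 ^ 2 * hth
  have b2 : (i c2 + i d2 * th) * (i c2 - i a * i d2 - i d2 * th) = i N2 := by
    have e1 := congrArg i hN2
    simp only [map_mul, map_sub, map_pow, map_add] at e1
    linear_combination -e1 - i d2 ^ 2 * hth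
  obtain ⟨D, hD⟩ : ∃ D : QuadraticAlgebra F (-b) (-a), D = (i l * th + i m) * (i c1 - i a * i d1 - i d1 * th) * (i c2 - i a * i d2 - i d2 * th) := ⟨_, rfl⟩
  have hfin : (i x3 - th) * i ((q * N1 * N2) ^ 2) = D ^ 2 := by
    rw [hD, mul_pow (_ * _) (i c2 - i a * i d2 - i d2 * th), mul_pow (i l * th + i m), ← a3, a1, a2]
    simp only [map_mul, map_pow]
    rw [← b1, ← b2]; ring
  have hr := congrArg QuadraticAlgebra.re hfin
  have hi := congrArg QuadraticAlgebra.im hfin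
  rw [pow_two D] at hr hi
  simp only [QuadraticAlgebra.re_mul, QuadraticAlgebra.im_mul, QuadraticAlgebra.re_sub, QuadraticAlgebra.im_sub, ire, iim, th] at hr hi
  have hQ : q * N1 * N2 ≠ 0 := mul_ne_zero (mul_ne_zero hq n1) n2
  refine ⟨D.re / (q * N1 * N2), D.im / (q * N1 * N2), ?_, ?_⟩
  · generalize q * N1 * N2 = Q at *
    field_simp
    linear_combination hr
  · generalize q * N1 * N2 = Q at *
    field_simp
    linear_combination hi

theorem SqL_of_U {q t z w : F} (h2 : (2 : F) ≠ 0) (hq : q ≠ 0) (hz : z ^ 2 = t ^ 4 + a * t ^ 2 + b) (hw : w ≠ 0)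
    (hU : a + 2 * t ^ 2 + 2 * z = q * w ^ 2) : SqL a b q (t ^ 2) := by
  refine ⟨(w - a / (q * w)) / 2, -1 / (q * w), ?_, ?_⟩
  · field_simp
    obtain ⟨U, hUd⟩ : ∃ U, U = a + 2 * t ^ 2 + 2 * z := ⟨_, rfl⟩
    have h1 : q * w ^ 2 = U := by rw [hUd, hU]
    have h3 : (U - a - 2 * t ^ 2) ^ 2 = 4 * (t ^ 4 + a * t ^ 2 + b) := by
      rw [← hz, hUd]; ring
    linear_combination -h3 - (q * w ^ 2 + U - 2 * a - 4 * t ^ 2) * h1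
  · field_simp
    ring

end generic

end EC

namespace EC
section weak
open WeierstrassCurve WeierstrassCurve.Affine

noncomputable def al : K := 21 + 4 * sq2
noncomputable def aa : K := 40 + 105 * sq2
noncomputable def bb : K := -473 - 168 * sq2
noncomputable def qq : K := 50 + 29 * sq2

theorem aa_eq : aa = 5 * sq2 * (21 + 4 * sq2) := by
  unfold aa; linear_combination (-20) * s_sq'
theorem bb_eq : bb = -al ^ 2 := by
  unfold bb al; linear_combination 16 * s_sq'
theorem qq_eq : qq = (2 + sq2) * (21 + 4 * sq2) := by
  unfold qq; linear_combination (-4) * s_sq'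
theorem al_ne : al ≠ 0 := by
  intro h
  have h1 : al * (21 - 4 * sq2) = 409 := by unfold al; linear_combination (-16) * s_sq'
  rw [h, zero_mul] at h1
  norm_num at h1
theorem bb_ne : bb ≠ 0 := by
  rw [bb_eq]; exact neg_ne_zero.2 (pow_ne_zero _ al_ne)
theorem s_ne : sq2 ≠ 0 := by
  intro h; have := s_sq'; rw [h] at this; norm_num at this
theorem qq_ne : qq ≠ 0 := by
  intro h
  have h1 : qq * (50 - 29 * sq2) = 818 := by unfold qq; linear_combination (-29^2) * s_sq'
  rw [h, zero_mul] at h1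
  norm_num at h1
theorem disc_eq : aa ^ 2 - 4 * bb = 54 * al ^ 2 := by
  rw [bb_eq, aa_eq, al]; linear_combination 25 * (21 + 4 * sq2) ^ 2 * s_sq'

noncomputable abbrev EE : WeierstrassCurve.Affine K := Wc aa bb

instance : EE.IsElliptic := by
  constructor
  rw [isUnit_iff_ne_zero]
  have : WeierstrassCurve.Δ EE = 16 * bb ^ 2 * (aa ^ 2 - 4 * bb) := by
    simp [WeierstrassCurve.Δ, WeierstrassCurve.b₂, WeierstrassCurve.b₄, WeierstrassCurve.b₆, WeierstrassCurve.b₈]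
    ring
  rw [this, disc_eq]
  have := bb_ne
  have := al_ne
  positivity

theorem six_ns (z : K) : z ^ 2 ≠ 6 := by
  intro h
  obtain ⟨x, y, rfl⟩ := K_rep z
  have h1 := K_uniq (x ^ 2 + 2 * y ^ 2 - 6) (2 * x * y) (by
    push_cast; linear_combination h - (y : K) ^ 2 * s_sq')
  have irr : ∀ (u : ℚ) (n : ℕ), ¬ IsSquare n → u ^ 2 ≠ n := by
    intro u n hn hu
    apply hn
    rw [← Rat.isSquare_natCast_iff]
    exact ⟨u, by rw [← hu]; ring⟩
  rcases mul_eq_zero.1 h1.2 with h2 | h2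
  · have h2 : x = 0 := by simpa using h2
    apply irr y 3 (by decide +kernel)
    rw [h2] at h1; push_cast; linarith [h1.1]
  · apply irr x 6 (by decide +kernel)
    rw [h2] at h1; push_cast; linarith [h1.1]

theorem disc_ns (z : K) : z ^ 2 ≠ aa ^ 2 - 4 * bb := by
  rw [disc_eq]
  intro h
  apply six_ns (z / (3 * al))
  have := al_ne
  field_simp
  linear_combination h

noncomputable def X0 : K := (20518 - 13932 * sq2) / 49
noncomputable def Y0 : K := (-3792792 + 2630487 * sq2) / 343
noncomputable def t0 : K := (86 - 81 * sq2) / 7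

theorem X0_sq : X0 = t0 ^ 2 := by
  unfold X0 t0; have := s_sq'; grind
theorem t0_ne : t0 ≠ 0 := by
  intro h
  have h1 : t0 * (86 + 81 * sq2) = -818 := by unfold t0; linear_combination (-81^2/7) * s_sq'
  rw [h, zero_mul] at h1
  norm_num at h1
theorem X0_ne : X0 ≠ 0 := by rw [X0_sq]; exact pow_ne_zero _ t0_ne

theorem P0_eqn : Y0 ^ 2 = X0 ^ 3 + aa * X0 ^ 2 + bb * X0 := by
  unfold X0 Y0 aa bb; have := s_sq'; grind

theorem SqL_X0 : SqL aa bb qq X0 := by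
  refine ⟨101/21 - 131/42 * sq2, -104/1227 + 137/2454 * sq2, ?_, ?_⟩
  · unfold X0 qq bb; have := s_sq'; grind
  · unfold qq aa; have := s_sq'; grind

theorem nP0 : EE.Nonsingular X0 Y0 := nons P0_eqn
theorem nT : EE.Nonsingular 0 0 := nons (by ring)
noncomputable def P0 : EE.Point := Point.some X0 Y0 nP0
noncomputable def TT : EE.Point := Point.some 0 0 nT

theorem sq_class {t Y : K} (ht : t ≠ 0) (h : EE.Nonsingular (t ^ 2) Y) :
    SqL aa bb 1 (t ^ 2) ∨ SqL aa bb qq (t ^ 2) := by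
  have e := pt_eqn h
  obtain ⟨z, hz⟩ : ∃ z, z = Y / t := ⟨_, rfl⟩
  have hY : Y = t * z := by rw [hz]; field_simp
  have hz2 : z ^ 2 = t ^ 4 + aa * t ^ 2 + bb := by
    apply mul_left_cancel₀ (pow_ne_zero 2 ht)
    rw [hY] at e
    linear_combination e
  obtain ⟨U, hU⟩ : ∃ U, U = aa + 2 * t ^ 2 + 2 * z := ⟨_, rfl⟩
  obtain ⟨U', hU'⟩ : ∃ U', U' = aa + 2 * t ^ 2 + 2 * (-z) := ⟨_, rfl⟩
  have hUU : U * U' = 54 * al ^ 2 := by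
    rw [← disc_eq, hU, hU']; linear_combination (-4) * hz2
  have hal := al_ne
  have hq := qq_ne
  have hs := s_ne
  have hU0 : U ≠ 0 := by
    rintro h0
    rw [h0, zero_mul] at hUU
    exact mul_ne_zero (by norm_num) (pow_ne_zero 2 hal) hUU.symm
  have h2 : (2 : K) ≠ 0 := by norm_num
  have hz2' : (-z) ^ 2 = t ^ 4 + aa * t ^ 2 + bb := by rw [← hz2]; ring
  obtain ⟨w, hw⟩ := D2 U (2 * t * U) hU0 (by
    have e1 : (10 * sq2 * (21 + 4 * sq2) : K) = 2 * aa := by rw [aa_eq]; ring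
    have e2 : (54 * (21 + 4 * sq2) ^ 2 : K) = aa ^ 2 - 4 * bb := by rw [disc_eq, al]
    rw [e1, e2, hU]; linear_combination (-4) * (aa + 2 * t ^ 2 + 2 * z) * hz2)
  rw [← qq_eq] at hw
  have hw0 : w ≠ 0 := by
    rintro rfl
    apply hU0; rcases hw with h | h | h | h <;> rw [h] <;> ring
  rcases hw with hw | hw | hw | hw
  · left; exact SqL_of_U h2 one_ne_zero hz2 hw0 (by rw [← hU, hw]; ring)
  · left
    refine SqL_of_U (w := 3 * sq2 * al / w) h2 one_ne_zero hz2' (by positivity) ?_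
    rw [hw] at hUU
    rw [← hU']
    field_simp
    linear_combination hUU / 3 - 9 * al ^ 2 * s_sq'
  · right; exact SqL_of_U h2 hq hz2 hw0 (by rw [← hU, hw])
  · right
    refine SqL_of_U (w := 3 * sq2 * al / (qq * w)) h2 hq hz2' (by positivity) ?_
    rw [hw] at hUU
    rw [← hU']
    field_simp
    linear_combination hUU / 3 - 9 * al ^ 2 * s_sq'

noncomputable def HH : AddSubgroup EE.Point := AddSubgroup.closure {P0, TT}
theorem P0_mem : P0 ∈ HH := AddSubgroup.subset_closure (by simp)
theorem T_mem : TT ∈ HH := AddSubgroup.subset_closure (by simp)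

theorem x_zero {x y : K} (h : EE.Nonsingular x y) (hx : x = 0) : Point.some x y h = TT := by
  have e := pt_eqn h
  subst hx
  apply some_congr rfl
  have : y ^ 2 = 0 := by rw [e]; ring
  exact pow_eq_zero_iff two_ne_zero |>.1 this

theorem weak_sq {t Y : K} (ht : t ≠ 0) (h : EE.Nonsingular (t ^ 2) Y) :
    ∃ g ∈ HH, ∃ R', Point.some _ _ h = g + (R' + R') := by
  have h2 : (2 : K) ≠ 0 := by norm_num
  rcases sq_class ht h with hs | hs
  · obtain ⟨R, hR⟩ := half bb_ne h2 ht h hs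
    exact ⟨0, HH.zero_mem, R, by rw [hR, zero_add]⟩
  · by_cases hx : t ^ 2 = X0
    · have e := pt_eqn h
      have : (Y - Y0) * (Y + Y0) = 0 := by
        have e0 := P0_eqn
        rw [hx] at e
        linear_combination e - e0
      rcases mul_eq_zero.1 this with hy | hy
      · exact ⟨P0, P0_mem, 0, by rw [add_zero, add_zero]; exact some_congr hx (sub_eq_zero.1 hy)⟩
      · refine ⟨-P0, HH.neg_mem P0_mem, 0, ?_⟩
        rw [add_zero, add_zero, P0, neg_pt nP0 (nons_neg nP0)]
        exact some_congr hx (by linear_combination hy)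
    · obtain ⟨l, m, x3, y3, h3, hadd, e1, e2, e3, v1, v2, v3⟩ :=
        add_vieta (h1 := h) (h2 := nP0) (fun hh => hx hh.1)
      have hadd' : Point.some _ _ h = Point.some x3 y3 h3 - P0 := by
        rw [← hadd, P0]; abel
      have hX0 := X0_sq
      have ht0 := t0_ne
      obtain ⟨u, hu⟩ : ∃ u, u = m / (t * t0) := ⟨_, rfl⟩
      have hx3 : x3 = u ^ 2 := by
        rw [hu]; field_simp; rw [← v3, hX0]; ring
      by_cases hu0 : u = 0
      · refine ⟨TT - P0, HH.sub_mem T_mem P0_mem, 0, ?_⟩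
        rw [hadd', x_zero h3 (by rw [hx3, hu0]; ring)]
        abel
      · have hsq := SqL_mul qq_ne disc_ns hs SqL_X0 v1 v2 v3
        subst hx3
        obtain ⟨R, hR⟩ := half bb_ne h2 hu0 h3 hsq
        exact ⟨-P0, HH.neg_mem P0_mem, R, by rw [hadd', hR]; abel⟩

theorem weak_mw (R : EE.Point) : ∃ g ∈ HH, ∃ R', R = g + (R' + R') := by
  rcases R with _ | ⟨x, y, h⟩
  · exact ⟨0, HH.zero_mem, 0, by simp; rfl⟩
  by_cases hx : x = 0
  · exact ⟨TT, T_mem, 0, by rw [x_zero h hx]; simp⟩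
  have e := pt_eqn h
  obtain ⟨w, hw⟩ := D1 x y hx (by rw [e, ← aa_eq, ← al, bb_eq]; ring)
  have hw0 : w ≠ 0 := by
    rintro rfl
    apply hx; rcases hw with h | h <;> rw [h] <;> ring
  rcases hw with hw | hw
  · subst hw; exact weak_sq hw0 h
  · obtain ⟨l, m, x3, y3, h3, hadd, e1, e2, e3, v1, v2, v3⟩ :=
        add_vieta (h1 := h) (h2 := nT) (fun hh => hx hh.1)
    have hm : m = 0 := by linear_combination -e2
    have hx3 : x3 = (al / w) ^ 2 := by
      have : x * x3 = bb := by rw [hm] at v2; linear_combination v2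
      field_simp
      rw [hw, bb_eq] at this
      linear_combination -this
    subst hx3
    obtain ⟨g, hg, R', hR⟩ := weak_sq (div_ne_zero al_ne hw0) h3
    refine ⟨g - TT, HH.sub_mem hg T_mem, R', ?_⟩
    have : Point.some x y h = Point.some _ _ h3 - TT := by rw [← hadd, TT]; abel
    rw [this, hR]; abel

end weak
end EC

namespace EC
section heights
open WeierstrassCurve WeierstrassCurve.Affine
variable {F : Type*} [Field F] [DecidableEq F] {a b : F} [(Wc a b).IsElliptic]
set_option linter.unusedSectionVars false

/-- evaluation of `addSubMap` on our curve -/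
theorem addSub_eval (s t u : F) : (fun i => (addSubMap (Wc a b) i).eval ![s, t, u]) =
    ![s ^ 2 - 2 * b * s * u + b ^ 2 * u ^ 2, 2 * t * s + 4 * a * s * u + 2 * b * t * u, t ^ 2 - 4 * s * u] := by
  funext i
  fin_cases i <;>
    simp [addSubMap, WeierstrassCurve.b₂, WeierstrassCurve.b₄, WeierstrassCurve.b₆, WeierstrassCurve.b₈]

theorem addSub_dbl (P : (Wc a b).Point) : ∃ c : F, c ≠ 0 ∧
    (fun i => (addSubMap (Wc a b) i).eval (P.sym2x P)) = c • (P + P).sym2x 0 := by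
  rcases P with _ | ⟨x, y, h⟩
  · refine ⟨1, one_ne_zero, ?_⟩
    rw [← Point.zero_def, add_zero, Point.sym2x_zero_zero, addSub_eval]
    simp
  · rw [Point.sym2x_some_some, addSub_eval]
    have e := pt_eqn h
    by_cases hy : y = -y
    · rw [add_opp ⟨rfl, hy⟩, Point.sym2x_zero_zero]
      have hns := h
      rw [WeierstrassCurve.Affine.nonsingular_iff'] at hns
      have hy2 : 2 * y = 0 := by linear_combination hy
      have h4 : 4 * (x ^ 3 + a * x ^ 2 + b * x) = 0 := by rw [← e]; linear_combination 2 * y * hy2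
      have hd : 3 * x ^ 2 + 2 * a * x + b ≠ 0 := by
        rcases hns.2 with h | h
        · intro h0; apply h; simp; linear_combination -h0
        · exfalso; apply h; simp; exact mul_eq_zero.1 hy2
      have h2 : (2 : F) ≠ 0 := by
        intro h2
        have hΔ := (Wc a b).isUnit_Δ.ne_zero
        apply hΔ
        simp [WeierstrassCurve.Δ, WeierstrassCurve.b₂, WeierstrassCurve.b₄, WeierstrassCurve.b₆, WeierstrassCurve.b₈]
        linear_combination (2 * a * 4 * a * b ^ 2 * 1 - 32 * b ^ 3) * h2
      have hy0 : y = 0 := by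
        rcases mul_eq_zero.1 hy2 with h | h
        · exact absurd h h2
        · exact h
      have hc : (x ^ 2 - b) ≠ 0 := by
        intro h0
        rw [hy0] at e
        have e1 : x ^ 2 * (2 * x + a) = 0 := by linear_combination -e - x * h0 + 2 * x * h0
        apply hd
        rcases mul_eq_zero.1 e1 with h | h
        · have : x = 0 := pow_eq_zero_iff two_ne_zero |>.1 h
          subst this
          linear_combination -h0
        · linear_combination -h0 + 2 * x * h
      refine ⟨(x ^ 2 - b) ^ 2, pow_ne_zero 2 hc, ?_⟩
      funext i
      fin_cases i
      · simp; ring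
      · simp; linear_combination h4
      · simp; ring
    · obtain ⟨l, m, x3, y3, h3, hadd, e1, e2, e3, v1, v2, v3⟩ :=
        add_vieta (h1 := h) (h2 := h) (fun hh => hy hh.2)
      rw [hadd, Point.sym2x_some_zero]
      have hll : 2 * l * y = 3 * x ^ 2 + 2 * a * x + b := by
        linear_combination v2 - 2 * x * v1 + 2 * l * e1
      have hy' : 2 * y ≠ 0 := fun h0 => hy (by linear_combination h0)
      refine ⟨(2 * y) ^ 2, pow_ne_zero 2 hy', ?_⟩
      funext i
      fin_cases i
      · simp
        linear_combination (-4 * y ^ 2) * v1 + 4 * (a + 2 * x) * e - (2 * l * y + (3 * x ^ 2 + 2 * a * x + b)) * hll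
      · simp; linear_combination (-4) * e
      · simp; ring

theorem addSub (P Q : (Wc a b).Point) : ∃ c : F, c ≠ 0 ∧
    (fun i => (addSubMap (Wc a b) i).eval (P.sym2x Q)) = c • (P + Q).sym2x (P - Q) := by
  by_cases hPQ : P.xRep = Q.xRep
  · rcases Point.eq_or_eq_neg_of_xRep_eq_xRep hPQ with h | h
    · subst h
      rw [sub_self]; exact addSub_dbl P
    · obtain ⟨c, hc, hh⟩ := addSub_dbl P
      have hQ : Q = -P := by rw [h, neg_neg]
      refine ⟨c, hc, ?_⟩
      rw [hQ, Point.sym2x_neg_right, add_neg_cancel, sub_neg_eq_add, hh, Point.sym2x_comm]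
  rcases P with _ | ⟨x1, y1, h1⟩
  · rcases Q with _ | ⟨x2, y2, h2⟩
    · exact absurd rfl hPQ
    · refine ⟨1, one_ne_zero, ?_⟩
      rw [← Point.zero_def, zero_add, zero_sub, Point.sym2x_neg_right, Point.sym2x_zero_some, addSub_eval, Point.sym2x_some_some]
      funext i
      fin_cases i <;> simp <;> ring
  · rcases Q with _ | ⟨x2, y2, h2⟩
    · refine ⟨1, one_ne_zero, ?_⟩
      rw [← Point.zero_def, add_zero, sub_zero, Point.sym2x_some_zero, addSub_eval, Point.sym2x_some_some]
      funext i
      fin_cases i <;> simp <;> ring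
    · have hx : x1 ≠ x2 := by
        rintro rfl; exact hPQ rfl
      have e1 := pt_eqn h1
      have e2 := pt_eqn h2
      obtain ⟨l, m, x3, y3, h3, hadd, f1, f2, f3, v1, v2, v3⟩ :=
        add_vieta (h1 := h1) (h2 := h2) (fun hh => hx hh.1)
      obtain ⟨l', m', x4, y4, h4, hadd', f1', f2', f3', v1', v2', v3'⟩ :=
        add_vieta (h1 := h1) (h2 := nons_neg h2) (fun hh => hx hh.1)
      rw [sub_eq_add_neg, neg_pt h2 (nons_neg h2), hadd, hadd', Point.sym2x_some_some, Point.sym2x_some_some, addSub_eval]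
      have hd : x1 - x2 ≠ 0 := sub_ne_zero.2 hx
      have q3 : (x1 - x2) ^ 2 * x3 = (y1 - y2) ^ 2 - (a + x1 + x2) * (x1 - x2) ^ 2 := by
        have : y1 - y2 = l * (x1 - x2) := by linear_combination f1 - f2
        rw [this]; linear_combination (x1 - x2) ^ 2 * v1
      have q4 : (x1 - x2) ^ 2 * x4 = (y1 + y2) ^ 2 - (a + x1 + x2) * (x1 - x2) ^ 2 := by
        have : y1 + y2 = l' * (x1 - x2) := by linear_combination f1' - f2'
        rw [this]; linear_combination (x1 - x2) ^ 2 * v1'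
      refine ⟨(x1 - x2) ^ 2, pow_ne_zero 2 hd, ?_⟩
      funext i
      fin_cases i
      · simp
        apply mul_left_cancel₀ (pow_ne_zero 2 hd)
        have : (x1 - x2) ^ 2 * ((x1 - x2) ^ 2 * (x3 * x4)) = (y1 ^ 2 - y2 ^ 2) ^ 2 - 2 * (a + x1 + x2) * (x1 - x2) ^ 2 * (y1 ^ 2 + y2 ^ 2) + (a + x1 + x2) ^ 2 * (x1 - x2) ^ 4 := by
          have : (x1 - x2) ^ 2 * ((x1 - x2) ^ 2 * (x3 * x4)) = ((x1 - x2) ^ 2 * x3) * ((x1 - x2) ^ 2 * x4) := by ring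
          rw [this, q3, q4]; ring
        rw [this, e1, e2]; ring
      · simp
        have : (x1 - x2) ^ 2 * (x3 + x4) = 2 * (y1 ^ 2 + y2 ^ 2) - 2 * (a + x1 + x2) * (x1 - x2) ^ 2 := by
          linear_combination q3 + q4
        rw [this, e1, e2]; ring
      · simp; ring

end heights

section fg
open WeierstrassCurve WeierstrassCurve.Affine Height

noncomputable def ht (P : EE.Point) : ℝ := logHeight P.xRep

theorem parallelogram : ∃ C : ℝ, ∀ P Q : EE.Point, |ht (P + Q) + ht (P - Q) - 2 * (ht P + ht Q)| ≤ C := by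
  obtain ⟨C1, h1⟩ := abs_logHeight_addSubMap_sub_two_mul_logHeight_le EE
  obtain ⟨C2, h2⟩ := abs_logHeight_sym2_sub_le K
  have h3 : ∀ P Q : EE.Point, |logHeight (P.sym2x Q) - (ht P + ht Q)| ≤ C2 := by
    intro P Q
    have key : ∀ v w : Fin 2 → K, v ≠ 0 → w ≠ 0 → 
        |logHeight ![v 0 * w 0, v 0 * w 1 + v 1 * w 0, v 1 * w 1] - (logHeight v + logHeight w)| ≤ C2 := by
      intro v w hv hw
      have ev : v = ![v 0, v 1] := by ext i; fin_cases i <;> rfl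
      have ew : w = ![w 0, w 1] := by ext i; fin_cases i <;> rfl
      have := h2 (a := v 0) (b := v 1) (c := w 0) (d := w 1) (by rwa [← ev]) (by rwa [← ew])
      rwa [← ev, ← ew] at this
    exact key _ _ P.xRep_ne_zero Q.xRep_ne_zero
  refine ⟨C1 + 3 * C2, fun P Q => ?_⟩
  obtain ⟨c, hc, hh⟩ := addSub P Q
  have e1 := h1 (P.sym2x Q)
  have e2 : logHeight (fun i => (addSubMap EE i).eval (P.sym2x Q)) = logHeight ((P + Q).sym2x (P - Q)) := by
    rw [hh, logHeight_smul_eq_logHeight _ hc]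
  rw [e2] at e1
  have e3 := h3 P Q
  have e4 := h3 (P + Q) (P - Q)
  rw [abs_le] at *
  constructor <;> linarith [e1.1, e1.2, e3.1, e3.2, e4.1, e4.2]

instance : Northcott ht := by
  constructor
  intro B
  have h1 : {x : K | logHeight₁ x ≤ B}.Finite := Northcott.finite_le B
  have h2 : ({![1, 0]} ∪ Set.image (fun x : K => ![x, 1]) {x : K | logHeight₁ x ≤ B}).Finite :=
    (Set.finite_singleton _).union (h1.image _)
  refine (h2.preimage' (f := fun P : EE.Point => P.xRep) ?_).subset ?_
  · intro v _
    by_cases hv : ∃ P : EE.Point, P.xRep = v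
    · obtain ⟨P, rfl⟩ := hv
      refine (Set.toFinite {P, -P}).subset ?_
      intro Q hQ
      exact Point.eq_or_eq_neg_of_xRep_eq_xRep hQ
    · convert Set.finite_empty
      ext P
      simp only [Set.mem_preimage, Set.mem_singleton_iff, Set.mem_empty_iff_false, iff_false]
      exact fun h => hv ⟨P, h⟩
  · rintro (_ | ⟨x, y, h⟩) hP
    · left; rfl
    · right
      refine ⟨x, ?_, rfl⟩
      change logHeight₁ x ≤ B
      rw [logHeight₁_eq_logHeight]
      exact hP

theorem HH_rep (g : EE.Point) (hg : g ∈ HH) : ∃ m n : ℤ, g = m • P0 + n • TT := by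
  rw [HH, AddSubgroup.mem_closure_pair] at hg
  obtain ⟨m, n, h⟩ := hg
  exact ⟨m, n, h.symm⟩

theorem EE_fg : AddGroup.FG EE.Point := by
  obtain ⟨C, hC⟩ := parallelogram
  refine AddCommGroup.fg_of_descent' (h := ht) (C := C) ?_ (fun P => logHeight_nonneg _) hC
  rw [AddSubgroup.finiteIndex_iff_finite_quotient]
  refine Finite.of_surjective (α := Bool × Bool)
    (fun p => QuotientAddGroup.mk ((if p.1 then P0 else 0) + (if p.2 then TT else 0))) ?_
  intro R
  obtain ⟨R, rfl⟩ := QuotientAddGroup.mk_surjective R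
  obtain ⟨g, hg, R', hR⟩ := weak_mw R
  obtain ⟨m, n, rfl⟩ := HH_rep g hg
  have par : ∀ (m : ℤ) (Q : EE.Point), ∃ (i : Bool) (k : ℤ), m • Q = (if i then Q else 0) + (k • Q + k • Q) := by
    intro m Q
    rcases Int.even_or_odd' m with ⟨k, rfl | rfl⟩
    · exact ⟨false, k, by simp [two_mul, add_smul]⟩
    · exact ⟨true, k, by simp [two_mul, add_smul]; abel⟩
  obtain ⟨i, k, hi⟩ := par m P0
  obtain ⟨j, k', hj⟩ := par n TT
  refine ⟨(i, j), ?_⟩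
  rw [QuotientAddGroup.eq]
  refine ⟨k • P0 + k' • TT + R', ?_⟩
  rw [hR, hi, hj]
  simp only [nsmulAddMonoidHom_apply, two_nsmul]
  abel

theorem odd_index : ∃ M : ℤ, M ≠ 0 ∧ ∀ R : EE.Point, ∃ m n : ℤ, M • R = m • P0 + n • TT := by
  have hfg := EE_fg
  have hmod : Module.Finite ℤ EE.Point := Module.Finite.iff_addGroup_fg.2 hfg
  have hq : Module.Finite ℤ (EE.Point ⧸ AddSubgroup.toIntSubmodule HH) := inferInstance
  obtain ⟨r, hr, hr2⟩ := Submodule.exists_sub_one_mem_and_smul_eq_zero_of_fg_of_le_smul (Ideal.span {(2 : ℤ)})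
    (⊤ : Submodule ℤ (EE.Point ⧸ AddSubgroup.toIntSubmodule HH)) hq.fg_top (by
      rintro x -
      obtain ⟨R, rfl⟩ := Submodule.Quotient.mk_surjective _ x
      obtain ⟨g, hg, R', hR⟩ := weak_mw R
      have : (Submodule.Quotient.mk R : EE.Point ⧸ AddSubgroup.toIntSubmodule HH) = (2 : ℤ) • Submodule.Quotient.mk R' := by
        rw [← Submodule.Quotient.mk_smul, Submodule.Quotient.eq, hR]
        have : g + (R' + R') - (2 : ℤ) • R' = g := by rw [two_smul]; abel
        rw [this]; exact hg
      rw [this]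
      exact Submodule.smul_mem_smul (Ideal.mem_span_singleton_self 2) trivial)
  refine ⟨r, ?_, fun R => ?_⟩
  · rintro rfl
    rw [Ideal.mem_span_singleton] at hr
    omega
  · apply HH_rep
    have := hr2 (Submodule.Quotient.mk R) trivial
    rw [← Submodule.Quotient.mk_smul, Submodule.Quotient.mk_eq_zero] at this
    exact this

end fg
end EC

namespace EC
section loc

theorem p5 : Prime (5 : ℤ) := Int.prime_iff_natAbs_prime.2 (by norm_num)

theorem n5_mul {m n : ℤ} (hm : ¬ (5 : ℤ) ∣ m) (hn : ¬ (5 : ℤ) ∣ n) : ¬ (5 : ℤ) ∣ m * n := by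
  intro h
  rcases p5.dvd_or_dvd h with h | h
  · exact hm h
  · exact hn h

/-- the localization of `ℤ[√2]` at the inert prime `5` -/
def A5 : Subring K where
  carrier := {x | ∃ n : ℤ, ¬ (5 : ℤ) ∣ n ∧ ∃ z : O, (n : K) * x = io z}
  mul_mem' := by
    rintro x y ⟨n, hn, z, hz⟩ ⟨m, hm, w, hw⟩
    refine ⟨n * m, n5_mul hn hm, z * w, ?_⟩
    rw [map_mul, ← hz, ← hw]; push_cast; ring
  add_mem' := by
    rintro x y ⟨n, hn, z, hz⟩ ⟨m, hm, w, hw⟩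
    refine ⟨n * m, n5_mul hn hm, m * z + n * w, ?_⟩
    rw [map_add, map_mul, map_mul, ← hz, ← hw, map_intCast, map_intCast]; push_cast; ring
  one_mem' := ⟨1, by decide, 1, by simp⟩
  zero_mem' := ⟨1, by decide, 0, by simp⟩
  neg_mem' := by
    rintro x ⟨n, hn, z, hz⟩
    exact ⟨n, hn, -z, by rw [map_neg, ← hz]; ring⟩

theorem A5_of {x : K} (n : ℤ) (z : O) (hn : ¬ (5 : ℤ) ∣ n) (h : (n : K) * x = io z) : x ∈ A5 :=
  ⟨n, hn, z, h⟩

theorem A5_io (z : O) : io z ∈ A5 := A5_of 1 z (by decide) (by simp)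

theorem A5_s : sq2 ∈ A5 := A5_of 1 ⟨0, 1⟩ (by decide) (by rw [io_mk]; push_cast; ring)

/-- explicit integrality test -/
theorem A5_num {x : K} (n u v : ℤ) (hn : ¬ (5 : ℤ) ∣ n) (h : (n : K) * x = u + v * sq2) : x ∈ A5 :=
  A5_of n ⟨u, v⟩ hn (by rw [io_mk, h])

theorem A5_inv_int {n : ℤ} (hn : ¬ (5 : ℤ) ∣ n) : (n : K)⁻¹ ∈ A5 := by
  apply A5_num n 1 0 hn
  have : (n : K) ≠ 0 := by
    intro h
    have : n = 0 := by exact_mod_cast h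
    exact hn (this ▸ dvd_zero _)
  rw [mul_inv_cancel₀ this]; push_cast; ring

theorem int_dvd_of {u v : ℤ} {y : K} (hy : y ∈ A5) (h : (u : K) + v * sq2 = 5 * y) : (5 : ℤ) ∣ u ∧ (5 : ℤ) ∣ v := by
  obtain ⟨n, hn, z, hz⟩ := hy
  have h1 : io (⟨n * u, n * v⟩ : O) = io (5 * z) := by
    rw [io_mk, map_mul, map_ofNat, ← hz]
    push_cast
    linear_combination (n : K) * h
  have h2 := io_inj h1
  have hr : n * u = 5 * z.re := by
    have := congrArg Zsqrtd.re h2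
    simpa using this
  have hi : n * v = 5 * z.im := by
    have := congrArg Zsqrtd.im h2
    simpa using this
  constructor
  · exact (p5.dvd_or_dvd (⟨_, hr⟩ : (5 : ℤ) ∣ n * u)).resolve_left hn
  · exact (p5.dvd_or_dvd (⟨_, hi⟩ : (5 : ℤ) ∣ n * v)).resolve_left hn

theorem norm5 {z : O} (h : (5 : ℤ) ∣ z.norm) : ∃ w : O, z = 5 * w := by
  obtain ⟨u, v⟩ := z
  have h1 : (5 : ℤ) ∣ u * u - 2 * (v * v) := by
    simpa [Zsqrtd.norm_def, mul_assoc] using h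
  have key : ∀ u v : ZMod 5, u * u - 2 * (v * v) = 0 → u = 0 ∧ v = 0 := by decide
  have h2 : ((u : ZMod 5)) * u - 2 * ((v : ZMod 5) * v) = 0 := by
    have := (ZMod.intCast_zmod_eq_zero_iff_dvd (u * u - 2 * (v * v)) 5).2 (by exact_mod_cast h1)
    push_cast at this; exact this
  obtain ⟨h3, h4⟩ := key _ _ h2
  have h3 := (ZMod.intCast_zmod_eq_zero_iff_dvd u 5).1 h3
  have h4 := (ZMod.intCast_zmod_eq_zero_iff_dvd v 5).1 h4
  obtain ⟨u', rfl⟩ := h3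
  obtain ⟨v', rfl⟩ := h4
  exact ⟨⟨u', v'⟩, by ext <;> simp⟩

theorem val_aux (N : ℕ) : ∀ (z : O) (m : ℤ), m ≠ 0 → m.natAbs ≤ N → ∀ x : K, x = io z / m →
    x ∈ A5 ∨ ∃ y ∈ A5, x⁻¹ = 5 * y := by
  induction N with
  | zero => intro z m hm h; exfalso; apply hm; omega
  | succ N ih =>
    intro z m hm hmN x hx
    have hmK : (m : K) ≠ 0 := by exact_mod_cast hm
    by_cases h5 : (5 : ℤ) ∣ m
    · obtain ⟨m', rfl⟩ := h5
      by_cases hz : (5 : ℤ) ∣ z.norm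
      · obtain ⟨w, rfl⟩ := norm5 hz
        apply ih w m' (by rintro rfl; exact hm (by ring)) (by omega) x
        rw [hx, map_mul, map_ofNat]
        push_cast
        have : (m' : K) ≠ 0 := by
          intro h; apply hmK; push_cast; rw [h]; ring
        field_simp
      · right
        have hn0 : (z.norm : K) ≠ 0 := by
          intro h
          have : z.norm = 0 := by exact_mod_cast h
          rw [this] at hz; exact hz (dvd_zero _)
        have hn : io z * io (star z) = z.norm := by
          rw [← map_mul, ← Zsqrtd.norm_eq_mul_conj, map_intCast]
        have hz0 : io z ≠ 0 := by
          intro h; rw [h, zero_mul] at hn; exact hn0 hn.symm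
        refine ⟨m' * (io (star z) * (z.norm : K)⁻¹), ?_, ?_⟩
        · exact mul_mem (intCast_mem _ _) (mul_mem (A5_io _) (A5_inv_int hz))
        · rw [hx, inv_div, ← hn]
          push_cast
          have : io (star z) ≠ 0 := by
            intro h; rw [h, mul_zero] at hn; exact hn0 hn.symm
          field_simp
    · left
      exact A5_of m z h5 (by rw [hx]; field_simp)

theorem A5_val (x : K) : x ∈ A5 ∨ ∃ y ∈ A5, x⁻¹ = 5 * y := by
  obtain ⟨z, n, hn, hx⟩ := K_frac x
  exact val_aux n z n (by exact_mod_cast hn) (by simp) x (by rw [hx]; simp)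

def II (k : ℕ) (x : K) : Prop := ∃ y ∈ A5, x = 5 ^ k * y

theorem II_zero (k) : II k 0 := ⟨0, A5.zero_mem, by ring⟩
theorem II0 {x} (h : x ∈ A5) : II 0 x := ⟨x, h, by ring⟩
theorem II.mem {k x} (h : II k x) : x ∈ A5 := by
  obtain ⟨y, hy, rfl⟩ := h
  exact mul_mem (pow_mem (ofNat_mem A5 5) k) hy
theorem II.add {k x y} (h : II k x) (h' : II k y) : II k (x + y) := by
  obtain ⟨u, hu, rfl⟩ := h
  obtain ⟨v, hv, rfl⟩ := h'
  exact ⟨u + v, add_mem hu hv, by ring⟩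
theorem II.neg {k x} (h : II k x) : II k (-x) := by
  obtain ⟨u, hu, rfl⟩ := h
  exact ⟨-u, neg_mem hu, by ring⟩
theorem II.sub {k x y} (h : II k x) (h' : II k y) : II k (x - y) := by
  rw [sub_eq_add_neg]; exact h.add h'.neg
theorem II.mul {j k x y} (h : II j x) (h' : II k y) : II (j + k) (x * y) := by
  obtain ⟨u, hu, rfl⟩ := h
  obtain ⟨v, hv, rfl⟩ := h'
  exact ⟨u * v, mul_mem hu hv, by ring⟩
theorem II.mulA {k x y} (h : II k x) (h' : y ∈ A5) : II k (x * y) := by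
  obtain ⟨u, hu, rfl⟩ := h
  exact ⟨u * y, mul_mem hu h', by ring⟩
theorem II.Amul {k x y} (h : II k x) (h' : y ∈ A5) : II k (y * x) := by
  rw [mul_comm]; exact h.mulA h'
theorem II.mono {j k x} (h : II j x) (hk : k ≤ j) : II k x := by
  obtain ⟨u, hu, rfl⟩ := h
  refine ⟨5 ^ (j - k) * u, mul_mem (pow_mem (ofNat_mem A5 5) _) hu, ?_⟩
  rw [← mul_assoc, ← pow_add]; congr 2; omega
theorem II5 (k : ℕ) : II k (5 ^ k) := ⟨1, A5.one_mem, by ring⟩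
theorem II.cancel {j k x} (h : II (j + k) (5 ^ j * x)) : II k x := by
  obtain ⟨u, hu, h⟩ := h
  refine ⟨u, hu, ?_⟩
  have h5 : (5 : K) ^ j ≠ 0 := pow_ne_zero _ (by norm_num)
  apply mul_left_cancel₀ h5
  rw [h, pow_add]; ring
theorem not_II1_one : ¬ II 1 1 := by
  rintro ⟨y, hy, h⟩
  have := int_dvd_of (u := 1) (v := 0) hy (by push_cast; linear_combination h)
  exact absurd this.1 (by decide)

theorem inv_mem {x : K} (hx : x ∈ A5) (h : ¬ II 1 x) : x ≠ 0 ∧ x⁻¹ ∈ A5 := by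
  refine ⟨?_, ?_⟩
  · rintro rfl; exact h (II_zero 1)
  · rcases A5_val x⁻¹ with h' | ⟨y, hy, h'⟩
    · exact h'
    · exfalso; apply h
      rw [inv_inv] at h'
      exact ⟨y, hy, by rw [h']; ring⟩

theorem unit1 {x : K} (h : II 1 x) : 1 + x ≠ 0 ∧ (1 + x)⁻¹ ∈ A5 := by
  apply inv_mem (add_mem A5.one_mem h.mem)
  intro h'
  apply not_II1_one
  have := h'.sub h
  simpa using this

theorem II_prime {x y : K} (hx : x ∈ A5) (h : II 1 (x * y)) : II 1 x ∨ II 1 y := by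
  by_cases h1 : II 1 x
  · exact Or.inl h1
  · right
    obtain ⟨h0, hi⟩ := inv_mem hx h1
    have := h.mulA hi
    rwa [mul_comm x, mul_assoc, mul_inv_cancel₀ h0, mul_one] at this

theorem sq_mem {y : K} (h : y ^ 2 ∈ A5) : y ∈ A5 := by
  rcases A5_val y with h' | ⟨z, hz, h'⟩
  · exact h'
  · by_cases hy : y = 0
    · rw [hy]; exact A5.zero_mem
    exfalso; apply not_II1_one
    have : (1 : K) = 5 ^ 1 * (5 * z ^ 2 * y ^ 2) := by
      have : z = y⁻¹ / 5 := by rw [h']; ring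
      rw [this]; field_simp
    exact ⟨_, mul_mem (mul_mem (ofNat_mem A5 5) (pow_mem hz 2)) h, this⟩

theorem II_int {u v : ℤ} (h : II 1 ((u : K) + v * sq2)) : (5 : ℤ) ∣ u ∧ (5 : ℤ) ∣ v := by
  obtain ⟨y, hy, h⟩ := h
  exact int_dvd_of hy (by rw [h]; ring)

end loc
end EC

namespace EC
section formal
open WeierstrassCurve WeierstrassCurve.Affine

theorem aa_mem : aa ∈ A5 := A5_num 1 40 105 (by decide) (by rw [aa]; push_cast; ring)
theorem bb_mem : bb ∈ A5 := A5_num 1 (-473) (-168) (by decide) (by rw [bb]; push_cast; ring)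

noncomputable def tt : EE.Point → K
  | Point.zero => 0
  | Point.some x y _ => x / y

/-- kernel-of-reduction filtration -/
def E1 (k : ℕ) : EE.Point → Prop
  | Point.zero => True
  | Point.some x y _ => y ≠ 0 ∧ II k (x / y) ∧ II (3 * k) (1 / y)

@[simp] theorem tt_zero : tt 0 = 0 := rfl
theorem E1_zero (k) : E1 k 0 := trivial
theorem tt_some {x y : K} (h : EE.Nonsingular x y) : tt (Point.some x y h) = x / y := rfl
theorem E1_some {k : ℕ} {x y : K} (h : EE.Nonsingular x y) :
    E1 k (Point.some x y h) ↔ y ≠ 0 ∧ II k (x / y) ∧ II (3 * k) (1 / y) := Iff.rfl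

theorem E1.tt {k : ℕ} {P : EE.Point} (h : E1 k P) : II k (tt P) := by
  rcases P with _ | ⟨x, y, hP⟩
  · exact II_zero k
  · exact h.2.1

theorem tt_neg (P : EE.Point) : tt (-P) = - tt P := by
  rcases P with _ | ⟨x, y, hP⟩
  · rw [← Point.zero_def]; simp
  · rw [neg_pt hP (nons_neg hP), tt_some, tt_some, div_neg]

theorem E1_neg {k : ℕ} {P : EE.Point} (h : E1 k P) : E1 k (-P) := by
  rcases P with _ | ⟨x, y, hP⟩
  · trivial
  · rw [neg_pt hP (nons_neg hP)]
    refine ⟨neg_ne_zero.2 h.1, ?_, ?_⟩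
    · rw [div_neg]; exact h.2.1.neg
    · rw [div_neg]; exact h.2.2.neg

/-- the equation in `t = x/y`, `w = 1/y` -/
theorem tw_eqn {x y : K} (h : EE.Nonsingular x y) (hy : y ≠ 0) :
    1 / y = (x / y) ^ 3 + aa * (x / y) ^ 2 * (1 / y) + bb * (x / y) * (1 / y) ^ 2 := by
  have e := pt_eqn h
  field_simp
  linear_combination e

theorem E1_up {k j : ℕ} {P : EE.Point} (hk : 1 ≤ k) (h : E1 k P) (ht : II j (EC.tt P)) (hj : 1 ≤ j) : E1 j P := by
  rcases P with _ | ⟨x, y, hP⟩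
  · trivial
  · refine ⟨h.1, ht, ?_⟩
    have ht : II j (x / y) := ht
    have e := tw_eqn hP h.1
    have hw := h.2.2
    generalize x / y = t at *
    generalize 1 / y = w at *
    have hu : II 1 (-(aa * t ^ 2) - bb * t * w) := by
      have h1 : II 1 t := ht.mono hj
      refine II.sub (II.neg ?_) ?_
      · rw [pow_two, ← mul_assoc]; exact h1.Amul (mul_mem aa_mem h1.mem)
      · exact (h1.Amul bb_mem).mulA hw.mem
    obtain ⟨hu0, hui⟩ := unit1 hu
    have : w = t ^ 3 * (1 + (-(aa * t ^ 2) - bb * t * w))⁻¹ := by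
      rw [eq_mul_inv_iff_mul_eq₀ hu0]; linear_combination e
    rw [this]
    refine II.mulA ?_ hui
    have := (ht.mul ht).mul ht
    have e3 : t ^ 3 = t * t * t := by ring
    rw [e3]; convert this using 1; ring

theorem E1_add {k : ℕ} (hk : 1 ≤ k) {P Q : EE.Point} (hP : E1 k P) (hQ : E1 k Q) :
    E1 k (P + Q) ∧ II (3 * k) (tt (P + Q) - (tt P + tt Q)) := by
  rcases P with _ | ⟨x1, y1, h1⟩
  · rw [← Point.zero_def, zero_add, tt_zero, zero_add, sub_self]
    exact ⟨hQ, II_zero _⟩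
  rcases Q with _ | ⟨x2, y2, h2⟩
  · rw [← Point.zero_def, add_zero, tt_zero, add_zero, sub_self]
    exact ⟨hP, II_zero _⟩
  by_cases hopp : x1 = x2 ∧ y1 = -y2
  · rw [add_opp hopp]
    refine ⟨trivial, ?_⟩
    rw [tt_zero, tt_some, tt_some, hopp.1, hopp.2, div_neg]
    convert II_zero _ using 1; ring
  obtain ⟨l, m, x3, y3, h3, hadd, f1, f2, f3, v1, v2, v3⟩ := add_vieta (h1 := h1) (h2 := h2) hopp
  rw [hadd]
  obtain ⟨hy1, ht1, hw1⟩ := hP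
  obtain ⟨hy2, ht2, hw2⟩ := hQ
  rw [tt_some, tt_some, tt_some]
  have E1' := tw_eqn h1 hy1
  have E2' := tw_eqn h2 hy2
  obtain ⟨t1, ht1d⟩ : ∃ t, t = x1 / y1 := ⟨_, rfl⟩
  obtain ⟨w1, hw1d⟩ : ∃ t, t = 1 / y1 := ⟨_, rfl⟩
  obtain ⟨t2, ht2d⟩ : ∃ t, t = x2 / y2 := ⟨_, rfl⟩
  obtain ⟨w2, hw2d⟩ : ∃ t, t = 1 / y2 := ⟨_, rfl⟩
  have g1 : l * t1 + m * w1 = 1 := by rw [ht1d, hw1d]; field_simp; linear_combination -f1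
  have g2 : l * t2 + m * w2 = 1 := by rw [ht2d, hw2d]; field_simp; linear_combination -f2
  rw [← ht1d] at ht1 E1' ⊢
  rw [← hw1d] at hw1 E1'
  rw [← ht2d] at ht2 E2' ⊢
  rw [← hw2d] at hw2 E2'
  have hIt : II 1 t1 := ht1.mono hk
  have hIt2 : II 1 t2 := ht2.mono hk
  have h3k : k ≤ 3 * k := by omega
  obtain ⟨u, hu⟩ : ∃ u, u = -(aa * t2 ^ 2) - bb * t2 * (w1 + w2) := ⟨_, rfl⟩
  obtain ⟨N, hN⟩ : ∃ N, N = t1 * t1 + t1 * t2 + t2 * t2 + aa * (t1 + t2) * w1 + bb * (w1 * w1) := ⟨_, rfl⟩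
  have hu1 : II 1 u := by
    rw [hu]
    refine II.sub (II.neg ?_) ?_
    · rw [pow_two, ← mul_assoc]; exact hIt2.Amul (mul_mem aa_mem hIt2.mem)
    · exact (hIt2.Amul bb_mem).mulA (add_mem hw1.mem hw2.mem)
  obtain ⟨hu0, hui⟩ := unit1 hu1
  have hN2 : II (2 * k) N := by
    rw [hN, two_mul]
    have a1 : II k w1 := hw1.mono h3k
    refine ((((ht1.mul ht1).add (ht1.mul ht2)).add (ht2.mul ht2)).add ?_).add ((a1.mul a1).Amul bb_mem)
    rw [mul_assoc]
    exact ((ht1.add ht2).mul a1).Amul aa_mem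
  have hdiff : (w1 - w2) * (1 + u) = (t1 - t2) * N := by
    rw [hu, hN]; linear_combination E1' - E2'
  have key : m * N + l * (1 + u) = 0 := by
    by_cases htt : t1 = t2
    · have hww : w1 = w2 := by
        rw [htt, sub_self, zero_mul] at hdiff
        rcases mul_eq_zero.1 hdiff with h | h
        · exact sub_eq_zero.1 h
        · exact absurd h hu0
      have hyy : y1 = y2 := by
        rw [hw1d, hw2d] at hww
        have := congrArg (fun z => 1 / z) hww
        simpa using this
      have hxx : x1 = x2 := by
        rw [ht1d, ht2d, hyy] at htt
        rwa [div_left_inj' hy2] at htt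
      subst hyy hxx
      have hll : 2 * l * y1 = 3 * x1 ^ 2 + 2 * aa * x1 + bb := by
        linear_combination v2 - 2 * x1 * v1 + 2 * l * f1
      subst htt hww
      have hx : x1 = t1 * y1 := by rw [ht1d]; field_simp
      have hyw : y1 * w1 = 1 := by rw [hw1d]; field_simp
      have hw0 : w1 ≠ 0 := by intro h; rw [h, mul_zero] at hyw; exact zero_ne_one hyw
      have hlw : 2 * l * w1 = 3 * t1 ^ 2 + 2 * aa * t1 * w1 + bb * w1 ^ 2 := by
        have hx' : x1 * w1 = t1 := by rw [hx]; linear_combination t1 * hyw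
        rw [← hx']
        linear_combination w1 ^ 2 * hll - 2 * l * w1 * hyw
      apply mul_left_cancel₀ hw0
      rw [hN, hu]
      linear_combination (3 * t1 ^ 2 + 2 * aa * t1 * w1 + bb * w1 ^ 2) * g1 - hlw + 3 * l * E1'
    · apply mul_left_cancel₀ (sub_ne_zero.2 htt)
      linear_combination (-m) * hdiff + (1 + u) * (g1 - g2)
  have hm : m ≠ 0 := by
    rintro rfl
    have : l * (1 + u) = 0 := by linear_combination key
    rcases mul_eq_zero.1 this with h | h
    · rw [h] at g1; simp at g1
    · exact hu0 h
  obtain ⟨la, hla⟩ : ∃ la, la = N * (1 + u)⁻¹ := ⟨_, rfl⟩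
  have hlaI : II (2 * k) la := by rw [hla]; exact hN2.mulA hui
  have hlal : l = -(la * m) := by
    rw [hla]; field_simp; linear_combination key
  obtain ⟨nu, hnu⟩ : ∃ nu, nu = 1 / m := ⟨_, rfl⟩
  have hnum : nu * m = 1 := by rw [hnu]; field_simp
  have hnu' : nu = w1 - la * t1 := by
    apply mul_right_cancel₀ hm
    rw [hnum, ← g1, hlal]; ring
  have hnuI : II (3 * k) nu := by
    rw [hnu']
    refine hw1.sub ?_
    have := hlaI.mul ht1
    convert this using 1; ring
  obtain ⟨v, hv⟩ : ∃ v, v = aa * la + bb * la ^ 2 := ⟨_, rfl⟩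
  have hlaI1 : II 1 la := hlaI.mono (by omega)
  have hv1 : II 1 v := by
    rw [hv, pow_two, ← mul_assoc]
    exact (hlaI1.Amul aa_mem).add (hlaI1.Amul (mul_mem bb_mem hlaI1.mem))
  obtain ⟨hD0, hDi⟩ := unit1 hv1
  have hprod : y1 * y2 * y3 = - (m ^ 3 * (1 + v)) := by
    rw [f1, f2, f3, hv]
    rw [hlal] at v1 v2 ⊢
    linear_combination (la * m) ^ 3 * v3 - (la * m) ^ 2 * m * v2 + la * m * m ^ 2 * v1
  have hy3 : y3 ≠ 0 := by
    rintro rfl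
    rw [mul_zero] at hprod
    exact mul_ne_zero (pow_ne_zero 3 hm) hD0 (by linear_combination hprod)
  have hsum : (1 + v) * (t1 + t2 - x3 / y3) = - (nu * (aa + 2 * bb * la)) := by
    have hx1 : x1 = t1 * y1 := by rw [ht1d]; field_simp
    have hx2 : x2 = t2 * y2 := by rw [ht2d]; field_simp
    have hnumr : x1 * y2 * y3 + x2 * y1 * y3 - x3 * y1 * y2 = m ^ 2 * (aa + 2 * bb * la) := by
      rw [f1, f2, f3]
      rw [hlal] at v1 v2 ⊢
      linear_combination (-3) * (la * m) ^ 2 * v3 + 2 * la * m * m * v2 - m ^ 2 * v1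
    have hD : (1 + v) = - (y1 * y2 * y3) / m ^ 3 := by
      rw [hprod]; field_simp
    rw [hD, hnu, ht1d, ht2d]
    field_simp
    linear_combination -hnumr
  have hdelta : x3 / y3 - (t1 + t2) = nu * (aa + 2 * bb * la) * (1 + v)⁻¹ := by
    rw [eq_mul_inv_iff_mul_eq₀ hD0]
    linear_combination -hsum
  have hdI : II (3 * k) (x3 / y3 - (t1 + t2)) := by
    rw [hdelta]
    refine II.mulA (II.mulA hnuI ?_) hDi
    exact add_mem aa_mem (mul_mem (mul_mem (ofNat_mem A5 2) bb_mem) hlaI.mem)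
  refine ⟨(E1_some h3).2 ⟨hy3, ?_, ?_⟩, hdI⟩
  · have := (hdI.mono h3k).add (ht1.add ht2)
    simpa using this
  · have hw3 : 1 / y3 = la * (x3 / y3) - nu := by
      field_simp
      rw [f3, hlal]
      linear_combination (la * x3 - 1) * hnum
    rw [hw3]
    refine II.sub ?_ hnuI
    have h4 := (hdI.mono h3k).add (ht1.add ht2)
    have h5 : II k (x3 / y3) := by simpa using h4
    have := hlaI.mul h5
    convert this using 1; ring

theorem E1_nsmul {k : ℕ} (hk : 1 ≤ k) {P : EE.Point} (hP : E1 k P) (n : ℕ) :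
    E1 k (n • P) ∧ II (3 * k) (tt (n • P) - n * tt P) := by
  induction n with
  | zero => rw [zero_smul]; exact ⟨trivial, by rw [tt_zero]; convert II_zero _ using 1; simp⟩
  | succ n ih =>
    rw [succ_nsmul]
    obtain ⟨a1, a2⟩ := E1_add hk ih.1 hP
    refine ⟨a1, ?_⟩
    have := a2.add ih.2
    convert this using 1
    push_cast; ring

/-- direction of a point in the kernel of reduction -/
def Dir (g : K) (k : ℕ) (P : EE.Point) : Prop :=
  1 ≤ k ∧ E1 k P ∧ ∃ c d : ℤ, ¬ (5 : ℤ) ∣ c ∧ ¬ (5 : ℤ) ∣ d ∧ II (k + 1) (d * tt P - 5 ^ k * (c * g))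

theorem Dir.nsmul_prime {g : K} {k : ℕ} {P : EE.Point} (h : Dir g k P) (n : ℕ) (hn : ¬ (5 : ℤ) ∣ n) :
    Dir g k (n • P) := by
  obtain ⟨hk, hE, c, d, hc, hd, hI⟩ := h
  obtain ⟨h1, h2⟩ := E1_nsmul hk hE n
  refine ⟨hk, h1, n * c, d, n5_mul hn hc, hd, ?_⟩
  have h3 := (h2.mono (show k + 1 ≤ 3 * k by omega)).Amul (intCast_mem A5 d)
  have h4 := hI.Amul (natCast_mem A5 n)
  convert h3.add h4 using 1
  push_cast; ring

theorem Dir.nsmul_five {g : K} {k : ℕ} {P : EE.Point} (h : Dir g k P) : Dir g (k + 1) (5 • P) := by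
  obtain ⟨hk, hE, c, d, hc, hd, hI⟩ := h
  obtain ⟨h1, h2⟩ := E1_nsmul hk hE 5
  have h5 : II 1 (5 : K) := by simpa using II5 1
  have h2' := h2.mono (show k + 2 ≤ 3 * k by omega)
  have ht : II (k + 1) (tt (5 • P)) := by
    have := (h2'.mono (show k + 1 ≤ k + 2 by omega)).add (hE.tt.mul h5)
    convert this using 1
    push_cast; ring
  refine ⟨by omega, E1_up hk h1 ht (by omega), c, d, hc, hd, ?_⟩
  have h3 := h2'.Amul (intCast_mem A5 d)
  have h4 := hI.mul h5
  convert h3.add h4 using 1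
  push_cast; ring

theorem Dir.nsmul {g : K} : ∀ (n : ℕ), 1 ≤ n → ∀ {k : ℕ} {P : EE.Point}, Dir g k P → ∃ j, Dir g j (n • P) := by
  intro n
  induction n using Nat.strong_induction_on with
  | _ n ih =>
    intro hn k P h
    by_cases h5 : (5 : ℤ) ∣ n
    · have h5' : 5 ∣ n := by exact_mod_cast h5
      obtain ⟨m, rfl⟩ := h5'
      obtain ⟨j, hj⟩ := ih m (by omega) (by omega) h.nsmul_five
      refine ⟨j, ?_⟩
      rwa [smul_smul, mul_comm] at hj
    · exact ⟨k, h.nsmul_prime n h5⟩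

theorem Dir.neg {g : K} {k : ℕ} {P : EE.Point} (h : Dir g k P) : Dir g k (-P) := by
  obtain ⟨hk, hE, c, d, hc, hd, hI⟩ := h
  refine ⟨hk, E1_neg hE, -c, d, by rwa [dvd_neg], hd, ?_⟩
  rw [tt_neg]
  convert hI.neg using 1
  push_cast; ring

theorem Dir.zsmul {g : K} (n : ℤ) (hn : n ≠ 0) {k : ℕ} {P : EE.Point} (h : Dir g k P) : ∃ j, Dir g j (n • P) := by
  obtain ⟨j, hj⟩ := Dir.nsmul n.natAbs (by omega) h
  refine ⟨j, ?_⟩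
  rcases Int.natAbs_eq n with h | h
  · rw [h, natCast_zsmul]; exact hj
  · rw [h, neg_smul, natCast_zsmul]; exact hj.neg

theorem Dir.ne {g g' : K} {u v u' v' : ℤ} (hg : II 1 (g - (u + v * sq2))) (hg' : II 1 (g' - (u' + v' * sq2)))
    (hdet : ¬ (5 : ℤ) ∣ u * v' - v * u') {k k' : ℕ} {P : EE.Point} (h : Dir g k P) (h' : Dir g' k' P) : False := by
  obtain ⟨hk, hE, c, d, hc, hd, hI⟩ := h
  obtain ⟨hk', hE', c', d', hc', hd', hI'⟩ := h'
  have gmem : ∀ {g : K} {u v : ℤ}, II 1 (g - (u + v * sq2)) → g ∈ A5 := by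
    intro g u v hg
    have : g = (g - (u + v * sq2)) + (u + v * sq2) := by ring
    rw [this]
    exact add_mem hg.mem (add_mem (intCast_mem _ _) (mul_mem (intCast_mem _ _) A5_s))
  have lt : ∀ {g : K} {u v : ℤ}, II 1 (g - (u + v * sq2)) → ¬ ((5 : ℤ) ∣ u ∧ (5 : ℤ) ∣ v) → ∀ {c d : ℤ} {k k' : ℕ} {t : K}, ¬ (5 : ℤ) ∣ c →
     II (k + 1) (d * t - 5 ^ k * (c * g)) → II k' t → k' ≤ k := by
    intro g u v hg huv c d k k' t hc hI ht
    by_contra hlt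
    push Not at hlt
    have h1 := ((ht.mono (show k + 1 ≤ k' by omega)).Amul (intCast_mem A5 d)).sub hI
    have h2 : II (k + 1) (5 ^ k * (c * g)) := by convert h1 using 1; ring
    have h3 := h2.cancel
    have h4 : II 1 (((c * u : ℤ) : K) + ((c * v : ℤ) : K) * sq2) := by
      convert h3.sub (hg.Amul (intCast_mem A5 c)) using 1
      push_cast; ring
    have h5 := II_int h4
    exact huv ⟨(p5.dvd_or_dvd h5.1).resolve_left hc, (p5.dvd_or_dvd h5.2).resolve_left hc⟩
  have e1 := lt hg (by
    rintro ⟨⟨x, rfl⟩, ⟨y, rfl⟩⟩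
    exact hdet ⟨x * v' - y * u', by ring⟩) hc hI hE'.tt
  have e2 := lt hg' (by
    rintro ⟨⟨x, rfl⟩, ⟨y, rfl⟩⟩
    exact hdet ⟨u * y - v * x, by ring⟩) hc' hI' hE.tt
  have e3 : k = k' := le_antisymm e2 e1
  subst e3
  have h1 := (hI'.Amul (intCast_mem A5 d)).sub (hI.Amul (intCast_mem A5 d'))
  have h2 : II (k + 1) (5 ^ k * (d' * c * g - d * c' * g')) := by
    convert h1 using 1; ring
  have h3 := h2.cancel
  have h4 : II 1 (((d' * c * u - d * c' * u' : ℤ) : K) + ((d' * c * v - d * c' * v' : ℤ) : K) * sq2) := by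
    convert (h3.sub (hg.Amul (intCast_mem A5 (d' * c)))).add (hg'.Amul (intCast_mem A5 (d * c'))) using 1
    push_cast; ring
  obtain ⟨⟨x, hx⟩, ⟨y, hy⟩⟩ := II_int h4
  have h6 : (5 : ℤ) ∣ (d' * c) * (u * v' - v * u') := ⟨x * v' - y * u', by linear_combination v' * hx - u' * hy⟩
  exact n5_mul (n5_mul hd' hc) hdet h6

end formal
end EC

namespace EC
section dblsec
open WeierstrassCurve WeierstrassCurve.Affine

theorem dbl {x y L x3 y3 : K} (h : EE.Nonsingular x y) (hy : y ≠ 0)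
    (hL : 2 * L * y = 3 * x ^ 2 + 2 * aa * x + bb) (hx3 : x3 = L ^ 2 - aa - 2 * x)
    (hy3 : y3 = -(L * (x3 - x) + y)) :
    ∃ h3 : EE.Nonsingular x3 y3, Point.some x y h + Point.some x y h = Point.some x3 y3 h3 := by
  have hopp : ¬ (x = x ∧ y = -y) := by
    rintro ⟨-, h⟩
    apply hy
    linear_combination h / 2
  obtain ⟨l, m, x4, y4, h4, hadd, f1, f2, f3, v1, v2, v3⟩ := add_vieta (h1 := h) (h2 := h) hopp
  have hl : 2 * l * y = 3 * x ^ 2 + 2 * aa * x + bb := by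
    linear_combination v2 - 2 * x * v1 + 2 * l * f1
  have hlL : l = L := by
    apply mul_right_cancel₀ hy
    linear_combination (hl - hL) / 2
  subst hlL
  have e1 : x4 = x3 := by linear_combination v1 - hx3
  have e2 : y4 = y3 := by rw [hy3, f3, e1]; linear_combination f1
  subst e1 e2
  exact ⟨h4, hadd⟩

noncomputable def L0 : K := (-18400 + (6147) * sq2) / 644

noncomputable def X1 : K := (25106537 + (-16957992) * sq2) / 207368

noncomputable def Y1 : K := (-175426389360 + (128104241205) * sq2) / 133544992

theorem L0_eq : 2 * L0 * Y0 = 3 * X0 ^ 2 + 2 * aa * X0 + bb := by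
  unfold L0 X0 Y0 aa bb
  linear_combination ((-509787/14)) * s_sq'

theorem X1_eq : X1 = L0 ^ 2 - aa - 2 * X0 := by
  unfold L0 X0 X1 aa
  linear_combination ((-37785609/414736)) * s_sq'

theorem Y1_eq : Y1 = -(L0 * (X1 - X0) + Y0) := by
  unfold L0 X0 X1 Y1 Y0
  linear_combination ((1403194131/725788)) * s_sq'

theorem Y1_ne : Y1 ≠ 0 := by
  intro h
  have e : Y1 * ((2276707071299328 + (1662553922923984) * sq2) / 198928585571556705) = 1 := by
    unfold Y1; linear_combination ((72936429398705866009/9097667313472526642)) * s_sq'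
  rw [h, zero_mul] at e; exact zero_ne_one e

noncomputable def L1 : K := (-225537835593069549392 + (1158091743081068636301) * sq2) / 85406672738721678680

noncomputable def X2 : K := (337585927514953419655652851173242625612833 + (-47636213808429796062467239417072370449392) * sq2) / 3647149874149552383167012235898583271200

noncomputable def Y2 : K := (-194750522175935002718353879328553907944688033445866784866873680 + (-121854635262487337190575167223469051811161825236427335271904497) * sq2) / 311490935730560776765271409115106780411167038734629698016000

theorem L1_eq : 2 * L1 * Y1 = 3 * X1 ^ 2 + 2 * aa * X1 + bb := by
  unfold L1 X1 Y1 aa bb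
  linear_combination ((3767973420415869262160576750619/162937620394845780993531008)) * s_sq'

theorem X2_eq : X2 = L1 ^ 2 - aa - 2 * X1 := by
  unfold L1 X1 X2 aa
  linear_combination ((-1341176485392547885639488449077703814962601/7294299748299104766334024471797166542400)) * s_sq'

theorem Y2_eq : Y2 = -(L1 * (X2 - X1) + Y1) := by
  unfold L1 X1 X2 Y2 Y1
  linear_combination ((788691318332240227728045483043259446477138964508941529213081/846442760137393415123020133464964077204258257431058962000)) * s_sq'

noncomputable def W2 : K := (-972114709052144073056086830683288368395084842230096890861641872640000 + (608248347585100895014452537275055570620063970318609800309030570256000) * sq2) / 131894965156750770334602498978638845346006657835651549736467687874035921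

noncomputable def T2 : K := (-29710807234685327267339362277261661330461136320 + (19363190011017475639170769535149592498765751540) * sq2) / 37014530677053860826616670356287324622668609561

theorem W2_eq : W2 * Y2 = 1 := by
  unfold W2 Y2; linear_combination ((-9762361692934794477224541137119181332311289458345999236242972693581584958141616736283320439469049893640753632073008210929/5411348861204277755540923735905590697324797894989546479005692823134478054694428681876624097771194811578385190265697632542)) * s_sq'

theorem T2_eq : T2 * Y2 = X2 := by
  unfold T2 Y2 X2; linear_combination ((-131521430117657338803771841677399243005173888459366506519693071304122144382598348665546917168685657375177/642680646389244951910431189750231523061868480713900573278769226220111523050268664618419849935342270400)) * s_sq'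

theorem W2_II : II 3 (W2) := by
  refine ⟨(W2) / 5 ^ 3, A5_num 131894965156750770334602498978638845346006657835651549736467687874035921 (-7776917672417152584448694645466306947160678737840775126893134981120) (4865986780680807160115620298200444564960511762548878402472244562048) (by decide) ?_, by ring⟩
  unfold W2; push_cast; ring

theorem T2_II : II 1 (T2) := by
  refine ⟨(T2) / 5 ^ 1, A5_num 37014530677053860826616670356287324622668609561 (-5942161446937065453467872455452332266092227264) (3872638002203495127834153907029918499753150308) (by decide) ?_, by ring⟩
  unfold T2; push_cast; ring

theorem T2_II2 : II 2 (T2 - 5 * (1 + 3 * sq2)) := by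
  refine ⟨(T2 - 5 * (1 + 3 * sq2)) / 5 ^ 2, A5_num 37014530677053860826616670356287324622668609561 (-8591338424798185256016908562347931377752167365) (-21434190805791617470403171432366411073650535675) (by decide) ?_, by ring⟩
  unfold T2; push_cast; ring

theorem Y2_ne : Y2 ≠ 0 := by
  intro h
  have e := W2_eq
  rw [h, mul_zero] at e; exact zero_ne_one e

theorem Y0_ne : Y0 ≠ 0 := by
  intro h
  have e1 : Y0 * (3792792 + 2630487 * sq2) = -(2 * (3792792 ^ 2 - 2 * 2630487 ^ 2)) / 686 := by
    unfold Y0; linear_combination (2630487 ^ 2 / 343) * s_sq'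
  rw [h, zero_mul] at e1
  norm_num at e1

theorem Dir_Q : Dir (1 + 3 * sq2) 1 ((4 : ℕ) • P0) := by
  obtain ⟨n1, e1⟩ := dbl nP0 Y0_ne L0_eq X1_eq Y1_eq
  obtain ⟨n2, e2⟩ := dbl n1 Y1_ne L1_eq X2_eq Y2_eq
  have e : (4 : ℕ) • P0 = Point.some X2 Y2 n2 := by
    rw [← e2, ← e1]
    change (4 : ℕ) • P0 = P0 + P0 + (P0 + P0)
    abel
  rw [e]
  have ht : X2 / Y2 = T2 := by rw [div_eq_iff Y2_ne, T2_eq]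
  have hw : 1 / Y2 = W2 := by rw [div_eq_iff Y2_ne, W2_eq]
  refine ⟨le_rfl, (E1_some n2).2 ⟨Y2_ne, ?_, ?_⟩, 1, 1, by decide, by decide, ?_⟩
  · rw [ht]; exact T2_II
  · rw [hw]; exact W2_II
  · rw [tt_some, ht]; convert T2_II2 using 1; push_cast; ring

end dblsec
end EC

namespace EC
section finish
open WeierstrassCurve WeierstrassCurve.Affine

theorem X0_mem : X0 ∈ A5 := A5_num 49 20518 (-13932) (by decide) (by unfold X0; push_cast; ring)
theorem Y0_mem : Y0 ∈ A5 := A5_num 343 (-3792792) 2630487 (by decide) (by unfold Y0; push_cast; ring)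

theorem Y0_unit : ¬ II 1 (2 * Y0) := by
  intro h
  have h1 := h.Amul (intCast_mem A5 343)
  have h2 : II 1 (((-7585584 : ℤ) : K) + ((5260974 : ℤ) : K) * sq2) := by
    convert h1 using 1
    unfold Y0; push_cast; ring
  exact absurd (II_int h2).1 (by decide)

theorem Dir_Z {X Y θ g : K} (h : EE.Nonsingular X Y) (hX : X ∈ A5) (hY : Y ∈ A5)
    (hYY : II 1 (Y - Y0)) {k : ℕ} (hk : 1 ≤ k) {c d : ℤ} (hc : ¬ (5 : ℤ) ∣ c) (hd : ¬ (5 : ℤ) ∣ d)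
    (hθ : θ ∈ A5) (hg : g ∈ A5) (hδ : d * (X - X0) = 5 ^ k * c * θ) (hne : X ≠ X0)
    (hθg : II 1 (-θ - g * (2 * Y0))) : Dir g k (Point.some X Y h + -P0) := by
  unfold P0
  rw [neg_pt nP0 (nons_neg nP0)]
  obtain ⟨l, m, x3, y3, h3, hadd, f1, f2, f3, v1, v2, v3⟩ :=
    add_vieta (h1 := h) (h2 := nons_neg nP0) (fun hh => hne hh.1)
  rw [hadd]
  obtain ⟨δ, hδd⟩ : ∃ δ, δ = X - X0 := ⟨_, rfl⟩
  have hδ0 : δ ≠ 0 := by rw [hδd]; exact sub_ne_zero.2 hne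
  rw [← hδd] at hδ
  have hd0 : (d : K) ≠ 0 := by
    intro hh
    apply hd
    have : d = 0 := by exact_mod_cast hh
    rw [this]; exact dvd_zero _
  have hδI : II k δ := by
    refine ⟨(d : K)⁻¹ * (c * θ), mul_mem (A5_inv_int hd) (mul_mem (intCast_mem _ _) hθ), ?_⟩
    field_simp
    linear_combination hδ
  have hδ1 : II 1 δ := hδI.mono hk
  obtain ⟨S, hS⟩ : ∃ S, S = Y + Y0 := ⟨_, rfl⟩
  have hSm : S ∈ A5 := by rw [hS]; exact add_mem hY Y0_mem
  have hlS : l * δ = S := by rw [hδd, hS]; linear_combination f2 - f1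
  obtain ⟨A, hA⟩ : ∃ A, A = aa + X + X0 := ⟨_, rfl⟩
  have hAm : A ∈ A5 := by rw [hA]; exact add_mem (add_mem aa_mem hX) X0_mem
  obtain ⟨B, hB⟩ : ∃ B, B = S * (A + X) - Y * δ := ⟨_, rfl⟩
  have hBm : B ∈ A5 := by
    rw [hB]; exact sub_mem (mul_mem hSm (add_mem hAm hX)) (mul_mem hY hδI.mem)
  have hl : l = S / δ := by rw [eq_div_iff hδ0, hlS]
  have hx3 : x3 * δ ^ 2 = S ^ 2 - δ ^ 2 * A := by
    rw [← hlS, hA]; linear_combination δ ^ 2 * v1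
  have hy3 : y3 * δ ^ 3 = - (S ^ 3 - δ ^ 2 * B) := by
    rw [f3, hB]
    have : m = Y - l * X := by linear_combination -f1
    rw [this]
    linear_combination (-S) * hx3 + (-δ ^ 2 * x3 + δ ^ 2 * X) * hlS
  obtain ⟨De, hDe⟩ : ∃ De, De = S ^ 3 - δ ^ 2 * B := ⟨_, rfl⟩
  obtain ⟨Nn, hNn⟩ : ∃ Nn, Nn = S ^ 2 - δ ^ 2 * A := ⟨_, rfl⟩
  rw [← hDe] at hy3
  rw [← hNn] at hx3
  have hSY : II 1 (S - 2 * Y0) := by convert hYY using 1; rw [hS]; ring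
  have hδB : II 1 (δ ^ 2 * B) := by
    rw [pow_two, mul_assoc]; exact hδ1.mulA (mul_mem hδ1.mem hBm)
  have hδA : II 1 (δ ^ 2 * A) := by
    rw [pow_two, mul_assoc]; exact hδ1.mulA (mul_mem hδ1.mem hAm)
  have hSn : ¬ II 1 S := by
    intro hh
    apply Y0_unit
    convert hh.sub hSY using 1; ring
  have hDem : De ∈ A5 := by rw [hDe]; exact sub_mem (pow_mem hSm 3) hδB.mem
  have hNm : Nn ∈ A5 := by rw [hNn]; exact sub_mem (pow_mem hSm 2) hδA.mem
  have hDen : ¬ II 1 De := by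
    intro hh
    have h1 : II 1 (S * (S * S)) := by
      convert hh.add hδB using 1; rw [hDe]; ring
    rcases II_prime hSm h1 with h2 | h2
    · exact hSn h2
    · rcases II_prime hSm h2 with h2 | h2 <;> exact hSn h2
  obtain ⟨hDe0, hDei⟩ := inv_mem hDem hDen
  have hy30 : y3 ≠ 0 := by
    rintro rfl
    rw [zero_mul] at hy3
    exact hDe0 (by linear_combination hy3)
  have ht : x3 / y3 = -δ * Nn * De⁻¹ := by
    have : De = - (y3 * δ ^ 3) := by rw [hy3]; ring
    rw [this, ← hx3]
    field_simp
  have hw : 1 / y3 = -δ * δ * δ * De⁻¹ := by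
    have : De = - (y3 * δ ^ 3) := by rw [hy3]; ring
    rw [this]
    field_simp
  refine ⟨hk, (E1_some h3).2 ⟨hy30, ?_, ?_⟩, c, d, hc, hd, ?_⟩
  · rw [ht]; exact (hδI.neg.mulA hNm).mulA hDei
  · rw [hw]
    have := (((hδI.neg.mul hδI).mul hδI).mulA hDei)
    convert this using 1; ring
  · rw [tt_some, ht]
    have e1 : II 1 (-θ * Nn - g * De) := by
      have a1 := (hθg.sub (hSY.Amul hg)).mulA (pow_mem hSm 2)
      have a2 := (hδA.Amul hθ).add (hδB.Amul hg)
      convert a1.add a2 using 1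
      rw [hNn, hDe]; ring
    have e2 := (e1.mulA hDei).Amul (intCast_mem A5 c)
    have e3 := (II5 k).mul e2
    convert e3 using 1
    field_simp
    linear_combination (-Nn) * hδ

theorem two_TT : (2 : ℤ) • TT = 0 := by
  rw [two_zsmul]
  exact add_opp ⟨rfl, by ring⟩

theorem Dir.ne_zero {g : K} {u v : ℤ} (hg : II 1 (g - (u + v * sq2))) (huv : ¬ (5 : ℤ) ∣ v) {k : ℕ} {P : EE.Point}
    (h : Dir g k P) (h0 : P = 0) : False := by
  subst h0
  obtain ⟨hk, hE, c, d, hc, hd, hI⟩ := h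
  refine Dir.ne (g' := 1) (u' := 1) (v' := 0) (k' := k) (P := 0) hg (by convert II_zero 1 using 1; push_cast; ring)
    ?_ ⟨hk, hE, c, d, hc, hd, hI⟩ ?_
  · intro hh; apply huv; simpa using hh
  · exfalso
    rw [tt_zero, mul_zero, zero_sub] at hI
    have h2 : II (k + 1) (5 ^ k * (c * g)) := by convert hI.neg using 1; ring
    have h3 := h2.cancel
    have h4 : II 1 (((c * u : ℤ) : K) + ((c * v : ℤ) : K) * sq2) := by
      convert h3.sub (hg.Amul (intCast_mem A5 c)) using 1
      push_cast; ring
    exact n5_mul hc huv (II_int h4).2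

theorem no_dir {k : ℕ} {Z : EE.Point} (h : Dir (3 + 2 * sq2) k Z) : False := by
  obtain ⟨M, hM, hMW⟩ := odd_index
  obtain ⟨m, n, e⟩ := hMW Z
  have e8 : (8 * M) • Z = (2 * m) • ((4 : ℕ) • P0) := by
    have e4 : (8 * M) • Z = (8 : ℤ) • (M • Z) := by rw [mul_smul]
    have e5 : (8 : ℤ) • (n • TT) = (4 * n) • ((2 : ℤ) • TT) := by
      rw [← mul_smul, ← mul_smul]; congr 1; ring
    rw [e4, e, smul_add, e5, two_TT, smul_zero, add_zero, ← natCast_zsmul, ← mul_smul, ← mul_smul]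
    congr 1; push_cast; ring
  have hg : II 1 ((3 + 2 * sq2 : K) - ((3 : ℤ) + (2 : ℤ) * sq2)) := by
    convert II_zero 1 using 1; push_cast; ring
  have hg' : II 1 ((1 + 3 * sq2 : K) - ((1 : ℤ) + (3 : ℤ) * sq2)) := by
    convert II_zero 1 using 1; push_cast; ring
  obtain ⟨j, hj⟩ := h.zsmul (8 * M) (by omega)
  by_cases hm : m = 0
  · refine Dir.ne_zero hg (by decide) hj ?_
    rw [e8, hm]; simp
  · obtain ⟨j', hj'⟩ := Dir_Q.zsmul (2 * m) (by omega)
    rw [e8] at hj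
    exact Dir.ne hg hg' (by decide) hj hj'

end finish
end EC

namespace EC
section fin2
open WeierstrassCurve WeierstrassCurve.Affine

noncomputable def x00 : K := (-2 / 49 : K) * (-663 + 458 * sq2)
noncomputable def y00 : K := (69 / 343 : K) * (-232 + 163 * sq2)

theorem X0_al : X0 = al * x00 := by
  unfold X0 al x00; linear_combination (3664 / 49) * s_sq'
theorem Y0_al : Y0 = al ^ 2 * y00 := by
  unfold Y0 al y00; have := s_sq'; grind

noncomputable def D0 : K := 9 / 2 + 2 * sq2
noncomputable def D0i : K := (18 - 8 * sq2) / 49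
theorem D0_D0i : D0 * D0i = 1 := by
  unfold D0 D0i; linear_combination (-16 / 49) * s_sq'
theorem D0_mem : D0 ∈ A5 := A5_num 2 9 4 (by decide) (by unfold D0; push_cast; ring)
theorem D0i_mem : D0i ∈ A5 := A5_num 49 18 (-8) (by decide) (by unfold D0i; push_cast; ring)

theorem x00_eq : x00 * D0 = (2 - sq2) * ((2 - sq2) * (13 / 2) + 4) := by
  unfold x00 D0; have := s_sq'; grind

theorem Xeq_aux {x y X Y : K} (hX : X = al * x) (hY : Y = al ^ 2 * y)
    (h : al * y ^ 2 = x ^ 3 + 5 * sq2 * x ^ 2 - x) : Y ^ 2 = X ^ 3 + aa * X ^ 2 + bb * X := by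
  rw [hX, hY, bb_eq, aa_eq]
  have : (21 + 4 * sq2 : K) = al := rfl
  rw [this]
  linear_combination al ^ 3 * h

/-- constant of proportionality -/
noncomputable def kap : K := -6 * (2 - sq2) ^ 2 * al
theorem kap_mem : kap ∈ A5 := by
  unfold kap al
  exact mul_mem (mul_mem (neg_mem (ofNat_mem A5 6)) (pow_mem (sub_mem (ofNat_mem A5 2) A5_s) 2))
    (add_mem (ofNat_mem A5 21) (mul_mem (ofNat_mem A5 4) A5_s))

theorem kap_cong : II 1 (-kap - (3 + 2 * sq2) * (2 * Y0) * D0 * D0) := by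
  refine ⟨(-kap - (3 + 2 * sq2) * (2 * Y0) * D0 * D0) / 5, A5_num 2 (30972) (15657) (by decide) ?_, by ring⟩
  unfold kap al Y0 D0; push_cast
  linear_combination (2/5) * ((-217219305/343) + (-191833848/343) * sq2^1 + (-42087792/343) * sq2^2) * s_sq'

theorem uniq {x y : K} {r : ℚ} (h : al * y ^ 2 = x ^ 3 + 5 * sq2 * x ^ 2 - x)
    (hr : x * ((r : K) - 2 + 2 * sq2) = (2 - sq2) * ((2 - sq2) * r + 4))
    (hden : ¬ (5 : ℤ) ∣ (r.den : ℤ)) (hnum : (5 : ℤ) ∣ r.num + (r.den : ℤ)) : x = x00 := by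
  by_contra hxne
  obtain ⟨X, hX⟩ : ∃ X, X = al * x := ⟨_, rfl⟩
  obtain ⟨Y, hY⟩ : ∃ Y, Y = al ^ 2 * y := ⟨_, rfl⟩
  have eqn := Xeq_aux hX hY h
  have hXne : X ≠ X0 := by
    rw [hX, X0_al]
    intro hh
    exact hxne (mul_left_cancel₀ al_ne hh)
  obtain ⟨q, hq⟩ : ∃ q : ℤ, q = r.den := ⟨_, rfl⟩
  obtain ⟨p, hp⟩ : ∃ p : ℤ, p = r.num := ⟨_, rfl⟩
  rw [← hq] at hden hnum
  rw [← hp] at hnum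
  have hq0 : q ≠ 0 := by rw [hq]; exact_mod_cast r.den_nz
  have hqr : (q : K) * r = p := by
    have h1 : (q : ℚ) * r = p := by
      rw [hq, hp]; push_cast; exact Rat.den_mul_eq_num r
    have h2 := congrArg (fun z : ℚ => (z : K)) h1
    push_cast at h2
    exact h2
  have hqK : (q : K) ≠ 0 := by exact_mod_cast hq0
  have hd : ¬ (5 : ℤ) ∣ 2 * q := n5_mul (by decide) hden
  -- ρ = r - 13/2
  obtain ⟨ρ, hρ⟩ : ∃ ρ : K, ρ = r - 13 / 2 := ⟨_, rfl⟩
  have hρq : ((2 * q : ℤ) : K) * ρ = ((2 * p - 13 * q : ℤ) : K) := by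
    rw [hρ]; push_cast; linear_combination 2 * hqr
  have h2q : ((2 * q : ℤ) : K) ≠ 0 := by push_cast; exact mul_ne_zero two_ne_zero hqK
  have h5 : (5 : ℤ) ∣ 2 * p - 13 * q := by omega
  have hρI : II 1 ρ := by
    obtain ⟨e, he⟩ := h5
    refine ⟨((2 * q : ℤ) : K)⁻¹ * e, mul_mem (A5_inv_int hd) (intCast_mem _ _), ?_⟩
    rw [he] at hρq
    field_simp
    rw [mul_comm, hρq]; push_cast; ring
  obtain ⟨hv0, hvi⟩ := unit1 (hρI.Amul D0i_mem)
  obtain ⟨D, hD⟩ : ∃ D : K, D = D0 + ρ := ⟨_, rfl⟩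
  have hDr : (r : K) - 2 + 2 * sq2 = D := by rw [hD, hρ, D0]; ring
  rw [hDr] at hr
  have hDv : D = D0 * (1 + D0i * ρ) := by rw [hD]; linear_combination (-ρ) * D0_D0i
  have hD0 : D0 ≠ 0 := by
    intro hh; have := D0_D0i; rw [hh, zero_mul] at this; exact zero_ne_one this
  have hDne : D ≠ 0 := by rw [hDv]; exact mul_ne_zero hD0 hv0
  have hD0i : D0⁻¹ ∈ A5 := by
    rw [inv_eq_of_mul_eq_one_right D0_D0i]; exact D0i_mem
  have hDi : D⁻¹ ∈ A5 := by rw [hDv, mul_inv]; exact mul_mem hD0i hvi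
  obtain ⟨θ, hθ⟩ : ∃ θ, θ = kap * (D⁻¹ * D0⁻¹) := ⟨_, rfl⟩
  have hθm : θ ∈ A5 := by rw [hθ]; exact mul_mem kap_mem (mul_mem hDi hD0i)
  have hdel : X - X0 = ρ * θ := by
    have e : (X - X0) * (D * D0) = ρ * kap := by
      rw [hX, X0_al]
      have e1 : al * x * (D * D0) = al * D0 * ((2 - sq2) * ((2 - sq2) * r + 4)) := by
        linear_combination al * D0 * hr
      have e2 : al * x00 * (D * D0) = al * D * ((2 - sq2) * ((2 - sq2) * (13 / 2) + 4)) := by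
        linear_combination al * D * x00_eq
      rw [sub_mul, e1, e2, ← hDr, hρ]
      unfold kap D0
      linear_combination al * (2 - sq2) * ((r : K) - 13 / 2) * (-2) * s_sq'
    rw [hθ]
    field_simp
    linear_combination e
  have hρ0 : ρ ≠ 0 := by
    rintro rfl
    rw [zero_mul] at hdel
    exact hXne (sub_eq_zero.1 hdel)
  have hz : 2 * p - 13 * q ≠ 0 := by
    intro hh
    rw [hh, Int.cast_zero] at hρq
    exact (mul_ne_zero h2q hρ0) hρq
  obtain ⟨k, c, hc, hkc⟩ : ∃ (k : ℕ) (c : ℤ), ¬ (5 : ℤ) ∣ c ∧ 2 * p - 13 * q = 5 ^ k * c := by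
    have hf : FiniteMultiplicity (5 : ℤ) (2 * p - 13 * q) :=
      Int.finiteMultiplicity_iff.2 ⟨by decide, hz⟩
    obtain ⟨c, h1, h2⟩ := hf.exists_eq_pow_mul_and_not_dvd
    exact ⟨_, c, h2, h1⟩
  have hk : 1 ≤ k := by
    rcases Nat.eq_zero_or_pos k with h0 | h0
    · rw [h0, pow_zero, one_mul] at hkc
      rw [hkc] at h5; exact absurd h5 hc
    · exact h0
  have hdI : II 1 (X - X0) := by rw [hdel]; exact hρI.mulA hθm
  have hXm : X ∈ A5 := by
    have : X = (X - X0) + X0 := by ring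
    rw [this]; exact add_mem hdI.mem X0_mem
  have hYm : Y ∈ A5 := by
    apply sq_mem
    rw [eqn]
    exact add_mem (add_mem (pow_mem hXm 3) (mul_mem aa_mem (pow_mem hXm 2))) (mul_mem bb_mem hXm)
  have hθg : II 1 (-θ - (3 + 2 * sq2) * (2 * Y0)) := by
    have hgm : (3 + 2 * sq2) * (2 * Y0) * D0 ∈ A5 :=
      mul_mem (mul_mem (add_mem (ofNat_mem A5 3) (mul_mem (ofNat_mem A5 2) A5_s))
        (mul_mem (ofNat_mem A5 2) Y0_mem)) D0_mem
    have e1 := (kap_cong.sub (hρI.Amul hgm)).mulA (mul_mem hDi hD0i)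
    convert e1 using 1
    rw [hθ]
    field_simp
    rw [hD]; ring
  have hgm : (3 + 2 * sq2 : K) ∈ A5 := add_mem (ofNat_mem A5 3) (mul_mem (ofNat_mem A5 2) A5_s)
  have hδ : ((2 * q : ℤ) : K) * (X - X0) = 5 ^ k * c * θ := by
    have : ((2 * p - 13 * q : ℤ) : K) = 5 ^ k * c := by rw [hkc]; push_cast; ring
    rw [hdel, ← mul_assoc, hρq, this]
  have hprod : II 1 ((Y - Y0) * (Y + Y0)) := by
    have : (Y - Y0) * (Y + Y0) = (X - X0) * (X ^ 2 + X * X0 + X0 ^ 2 + aa * (X + X0) + bb) := by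
      linear_combination eqn - P0_eqn
    rw [this]
    refine hdI.mulA ?_
    exact add_mem (add_mem (add_mem (add_mem (pow_mem hXm 2) (mul_mem hXm X0_mem)) (pow_mem X0_mem 2))
      (mul_mem aa_mem (add_mem hXm X0_mem))) bb_mem
  rcases II_prime (sub_mem hYm Y0_mem) hprod with h1 | h1
  · exact no_dir (Dir_Z (nons eqn) hXm hYm h1 hk hc hd hθm hgm hδ hXne hθg)
  · have eqn' : (-Y) ^ 2 = X ^ 3 + aa * X ^ 2 + bb * X := by rw [neg_sq]; exact eqn
    refine no_dir (Dir_Z (nons eqn') hXm (neg_mem hYm) ?_ hk hc hd hθm hgm hδ hXne hθg)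
    convert h1.neg using 1; ring

theorem xy00 : al * y00 ^ 2 = x00 ^ 3 + 5 * sq2 * x00 ^ 2 - x00 := by
  unfold al y00 x00; have := s_sq'; grind

theorem s_rat {p q : ℚ} (h : (p : K) + q * sq2 = 0) : p = 0 ∧ q = 0 := K_uniq p q h

end fin2
end EC

/-- **Elliptic Chabauty for `D = 409`, `α = 21 + 4√2`.**
Let `K = ℚ(√2)`, `s = √2` and `α = 21 + 4s`. The set of points `(x, y)` on the curve
`α·y² = x³ + 5s·x² − x` (with `x ≠ 6 − 4s`) for which
`π(x) = 2(−4 + 2s − x(1 − s))/(6 − 4s − x)` is a rational number congruent to `−1` modulo `5`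
consists exactly of the two points `(x₀, ±y₀)` with `x₀ = (−2/49)(−663 + 458s)` and
`y₀ = (69/343)(−232 + 163s)`. -/
theorem elliptic_chabauty_409 :
    {P : Qsqrt2 × Qsqrt2 |
        (21 + 4 * sq2) * P.2 ^ 2 = P.1 ^ 3 + 5 * sq2 * P.1 ^ 2 - P.1 ∧
        P.1 ≠ 6 - 4 * sq2 ∧
        ∃ r : ℚ, (r : Qsqrt2) = 2 * (-4 + 2 * sq2 - P.1 * (1 - sq2)) / (6 - 4 * sq2 - P.1) ∧
          ¬ (5 : ℤ) ∣ (r.den : ℤ) ∧ (5 : ℤ) ∣ (r.num + (r.den : ℤ))} =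
      {((-2 / 49 : Qsqrt2) * (-663 + 458 * sq2), (69 / 343 : Qsqrt2) * (-232 + 163 * sq2)),
        ((-2 / 49 : Qsqrt2) * (-663 + 458 * sq2), -((69 / 343 : Qsqrt2) * (-232 + 163 * sq2)))} := by
  change _ = {(EC.x00, EC.y00), (EC.x00, -EC.y00)}
  have hs := EC.s_sq'
  have hne : 6 - 4 * sq2 - EC.x00 ≠ 0 := by
    intro h
    have := EC.s_rat (p := 6 - 1326 / 49) (q := -4 + 916 / 49) (by
      rw [← h, EC.x00]; push_cast; ring)
    norm_num at this
  ext ⟨x, y⟩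
  simp only [Set.mem_ofPred_eq, Set.mem_insert_iff, Set.mem_singleton_iff, Prod.mk.injEq]
  constructor
  · rintro ⟨h, hx, r, hr, hden, hnum⟩
    have hx' : 6 - 4 * sq2 - x ≠ 0 := sub_ne_zero.2 (Ne.symm hx)
    rw [eq_div_iff hx'] at hr
    have e : x = EC.x00 := EC.uniq (r := r) h (by linear_combination -hr - (r : Qsqrt2) * hs) hden hnum
    have h0 := EC.xy00
    rw [e] at h
    have h2 : EC.al * ((y - EC.y00) * (y + EC.y00)) = 0 := by
      have h' : EC.al * y ^ 2 = EC.x00 ^ 3 + 5 * sq2 * EC.x00 ^ 2 - EC.x00 := h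
      linear_combination h' - h0
    rcases mul_eq_zero.1 ((mul_eq_zero.1 h2).resolve_left EC.al_ne) with h3 | h3
    · exact Or.inl ⟨e, sub_eq_zero.1 h3⟩
    · exact Or.inr ⟨e, eq_neg_of_add_eq_zero_left h3⟩
  · intro hh
    have hx : x = EC.x00 := by rcases hh with hh | hh <;> exact hh.1
    have hy : y ^ 2 = EC.y00 ^ 2 := by
      rcases hh with hh | hh <;> rw [hh.2]
      ring
    rw [hy, hx]
    refine ⟨EC.xy00, fun h => hne (by rw [h]; ring), 13 / 2, ?_, ?_, ?_⟩
    · rw [eq_div_iff hne, EC.x00]; push_cast; linear_combination (1832 / 49 : Qsqrt2) * hs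
    · have : (13 / 2 : ℚ).den = 2 := by norm_num
      rw [this]; decide
    · have h1 : (13 / 2 : ℚ).den = 2 := by norm_num
      have h2 : (13 / 2 : ℚ).num = 13 := by norm_num
      rw [h1, h2]; decide
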